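/- There exists a function Θ(m,r,n,d), independent of N and of K, with the following property: for every algebraically closed field K and every N, given an m × r matrix over R = K[x_1,…,x_N] with entries of degree at most d, regarded as an R-linear map R^r → R^m, and given a submodule M of R^m with a generating set bounded by (n,d), the kernel of the composite map R^r → R^m → R^m/M has a generating set bounded by (Θ(m,r,n,d), Θ(m,r,n,d)). -/

import Mathlib

universe u v w

section FlatExchange

open Polynomial

theorem RingHom.flat_iff_exists_of_sum_mul_eq_zero {B R : Type*} [CommRing B] [CommRing R]
    (φ : B →+* R) :
    φ.Flat ↔ ∀ {l : ℕ} {f : Fin l → B} {x : Fin l → R}, ∑ i, φ (f i) * x i = 0 →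
      ∃ (k : ℕ) (a : Fin l → Fin k → B) (y : Fin k → R),
        (∀ i, x i = ∑ j, φ (a i j) * y j) ∧ ∀ j, ∑ i, f i * a i j = 0 := by
  let := φ.toAlgebra
  exact Module.Flat.iff_forall_isTrivialRelation (R := B) (M := R)

theorem RingHom.Flat.polynomial_mapRingHom {B R : Type u} [CommRing B] [CommRing R]
    {φ : B →+* R} (h : φ.Flat) : (Polynomial.mapRingHom φ).Flat := by
  algebraize [φ]
  let := Polynomial.algebra B R
  exact RingHom.Flat.isStableUnderBaseChange B R B[X] R[X] h

/-- Multiplication by a monic polynomial is injective modulo an extended ideal. -/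
theorem Polynomial.Monic.mem_map_C_of_mul_mem {A : Type*} [CommRing A] {P : A[X]} (hP : P.Monic)
    {J : Ideal A} {b : A[X]} (h : P * b ∈ J.map C) : b ∈ J.map C := by
  have key : ∀ q : A[X], q ∈ J.map C ↔ q.map (Ideal.Quotient.mk J) = 0 := fun q => by
    simp [Ideal.mem_map_C_iff, Polynomial.ext_iff, Ideal.Quotient.eq_zero_iff_mem]
  rw [key] at h ⊢
  rw [Polynomial.map_mul] at h
  exact ((hP.map _).mul_right_eq_zero_iff).1 h

theorem RingHom.Flat.eval₂RingHom_exchange {B R : Type u} [CommRing B] [CommRing R]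
    (φ : B →+* R) (z y : R) (h : (eval₂RingHom φ z).Flat) (P : B[X][X]) (hP : P.Monic)
    (hz : eval₂ (eval₂RingHom φ y) z P = 0) : (eval₂RingHom φ y).Flat := by
  set ψ : B[X] →+* R[X] := mapRingHom φ with hψ
  set Ψ : B[X][X] →+* R[X] := eval₂RingHom ψ (C z) with hΨ
  have hΨflat : Ψ.Flat := by
    have : Ψ = (mapRingHom (eval₂RingHom φ z)).comp
        (Polynomial.Bivariate.swap (R := B) : B[X][X] →+* B[X][X]) := by
      refine Polynomial.ringHom_ext' (Polynomial.ringHom_ext' ?_ ?_) ?_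
      · ext b : 1
        have := Bivariate.swap_C_C b
        simp_all
      · have := Bivariate.swap_X (R := B)
        simp_all
      · have := Bivariate.swap_Y (R := B)
        simp_all
    rw [this]
    refine RingHom.Flat.comp (RingHom.Flat.of_bijective ?_) h.polynomial_mapRingHom
    exact (Polynomial.Bivariate.swap (R := B)).bijective
  have hψflat : ψ.Flat := by
    have : ψ = Ψ.comp C := by ext <;> simp [hψ, hΨ]
    rw [this]
    refine RingHom.Flat.comp ?_ hΨflat
    exact (RingHom.flat_algebraMap_iff (R := B[X]) (S := B[X][X])).2 inferInstance
  have hev : ∀ q : B[X], (ψ q).eval y = eval₂RingHom φ y q := by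
    intro q; simp [hψ, eval_map]
  have hevΨ : ∀ q : B[X][X], (Ψ q).eval y = eval₂ (eval₂RingHom φ y) z q := by
    intro q
    have : (evalRingHom y).comp Ψ = eval₂RingHom (eval₂RingHom φ y) z := by
      ext <;> simp [hψ, hΨ]
    exact congrArg (fun g : B[X][X] →+* R => g q) this
  obtain ⟨w, hw⟩ : (X - C y : R[X]) ∣ Ψ P := by
    rw [dvd_iff_isRoot, IsRoot, hevΨ, hz]
  rw [RingHom.flat_iff_exists_of_sum_mul_eq_zero] at hΨflat hψflat ⊢
  intro l f x hx
  obtain ⟨s, hs⟩ : (X - C y : R[X]) ∣ ∑ i, ψ (f i) * C (x i) := by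
    rw [dvd_iff_isRoot, IsRoot, eval_finsetSum]
    simpa [hev] using hx
  -- `s` lies in the ideal generated by the coefficients of the relation
  have hPs : Ψ P * s - ∑ i, ψ (f i) * (w * C (x i)) = 0 := by
    rw [hw]
    have : ∑ i, ψ (f i) * (w * C (x i)) = w * ∑ i, ψ (f i) * C (x i) := by
      rw [Finset.mul_sum]; exact Finset.sum_congr rfl fun i _ => by ring
    rw [this, hs]; ring
  obtain ⟨k, a, ρ, h1, h2⟩ := hΨflat (l := l + 1)
    (f := Fin.cons P fun i => - C (f i)) (x := Fin.cons s fun i => w * C (x i)) (by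
      rw [Fin.sum_univ_succ]
      simpa [hΨ, Finset.sum_neg_distrib, sub_eq_add_neg] using hPs)
  set J : Ideal B[X] := Ideal.span (Set.range f) with hJ
  have hb : ∀ j, a 0 j ∈ J.map C := by
    intro j
    apply hP.mem_map_C_of_mul_mem
    have := h2 j
    rw [Fin.sum_univ_succ] at this
    simp only [Fin.cons_zero, Fin.cons_succ] at this
    rw [eq_neg_of_add_eq_zero_left this]
    refine neg_mem (sum_mem fun i _ => Ideal.mul_mem_right _ _ (neg_mem ?_))
    exact Ideal.mem_map_of_mem _ (Ideal.subset_span ⟨i, rfl⟩)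
  have hsJ : s ∈ J.map ψ := by
    have h0 := h1 0
    rw [Fin.cons_zero] at h0
    rw [h0]
    refine sum_mem fun j _ => Ideal.mul_mem_right _ _ ?_
    have := Ideal.mem_map_of_mem Ψ (hb j)
    rw [Ideal.map_map] at this
    convert this using 2
    ext <;> simp [hψ, hΨ]
  obtain ⟨c, hc⟩ : ∃ c : Fin l → R[X], s = ∑ i, ψ (f i) * c i := by
    rw [hJ, Ideal.map_span, ← Set.range_comp, Ideal.mem_span_range_iff_exists_fun] at hsJ
    obtain ⟨c, hc⟩ := hsJ
    exact ⟨c, by rw [← hc]; exact Finset.sum_congr rfl fun i _ => mul_comm _ _⟩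
  obtain ⟨k', a', ρ', h1', h2'⟩ := hψflat (f := f) (x := fun i => C (x i) - (X - C y) * c i) (by
    simp only [mul_sub, Finset.sum_sub_distrib, hs]
    rw [sub_eq_zero]
    conv_lhs => rw [hc]
    rw [Finset.mul_sum]
    exact Finset.sum_congr rfl fun i _ => by ring)
  refine ⟨k', a', fun j => (ρ' j).eval y, fun i => ?_, h2'⟩
  have := congrArg (eval y) (h1' i)
  simpa [eval_finsetSum, hev] using this

end FlatExchange

section BoundedKernels

open MvPolynomial Matrix

/-- The kernel of the matrix `A` is generated by `t` vectors with entries of degree at most `t`. -/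
def KerBounded {σ K m κ : Type*} [Field K] [Fintype κ] (A : Matrix m κ (MvPolynomial σ K))
    (t : ℕ) : Prop :=
  ∃ h : Fin t → κ → MvPolynomial σ K, (∀ a l, (h a l).totalDegree ≤ t) ∧ (∀ a, A *ᵥ h a = 0) ∧
    ∀ x, A *ᵥ x = 0 → ∃ c : Fin t → MvPolynomial σ K, x = ∑ a, c a • h a

theorem KerBounded.of_fintype {σ K m κ α : Type*} [Field K] [Fintype κ] [Fintype α]
    {A : Matrix m κ (MvPolynomial σ K)} {t : ℕ} (h : α → κ → MvPolynomial σ K)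
    (hα : Fintype.card α ≤ t) (hdeg : ∀ a l, (h a l).totalDegree ≤ t) (hker : ∀ a, A *ᵥ h a = 0)
    (hgen : ∀ x, A *ᵥ x = 0 → ∃ c : α → MvPolynomial σ K, x = ∑ a, c a • h a) :
    KerBounded A t := by
  classical
  obtain ⟨f⟩ : Nonempty (α ↪ Fin t) := Function.Embedding.nonempty_of_card_le (by simpa using hα)
  refine ⟨Function.extend f h 0, fun a l => ?_, fun a => ?_, fun x hx => ?_⟩
  · by_cases ha : ∃ b, f b = a
    · obtain ⟨b, rfl⟩ := ha
      rw [f.injective.extend_apply]; exact hdeg b l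
    · rw [Function.extend_apply' _ _ _ ha]; simp
  · by_cases ha : ∃ b, f b = a
    · obtain ⟨b, rfl⟩ := ha
      rw [f.injective.extend_apply]; exact hker b
    · rw [Function.extend_apply' _ _ _ ha]; simp
  · obtain ⟨c, hc⟩ := hgen x hx
    refine ⟨Function.extend f c 0, ?_⟩
    rw [hc]
    have : ∀ a : Fin t, a ∉ Finset.univ.map f →
        Function.extend f c 0 a • Function.extend f h 0 a = 0 := by
      intro a ha
      rw [Function.extend_apply' _ _ _ (by simpa using ha)]; simp
    rw [← Finset.sum_subset (Finset.subset_univ _) fun a _ => this a, Finset.sum_map]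
    simp [f.injective.extend_apply]

theorem KerBounded.of_reindex {σ K m κ κ' : Type*} [Field K] [Fintype κ] [Fintype κ']
    {A : Matrix m κ (MvPolynomial σ K)} {t : ℕ} (e : κ' ≃ κ)
    (h : KerBounded (fun i j => A i (e j)) t) : KerBounded A t := by
  obtain ⟨h, h1, h2, h3⟩ := h
  have key : ∀ x : κ → MvPolynomial σ K,
      A *ᵥ x = (fun i j => A i (e j) : Matrix m κ' _) *ᵥ (x ∘ e) := by
    intro x; ext1 i
    exact (Equiv.sum_comp e fun j => A i j * x j).symm
  refine ⟨fun a => h a ∘ e.symm, fun a l => h1 a _, fun a => ?_, fun x hx => ?_⟩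
  · rw [key, ← h2 a]; congr 1; ext; simp
  · obtain ⟨c, hc⟩ := h3 (x ∘ e) (by rw [← key, hx])
    refine ⟨c, ?_⟩
    ext1 j
    have := congrFun hc (e.symm j)
    simpa using this

/-- The bound on kernels of matrices obtained by treating the rows one after the other, starting
from a bound `β` on the kernels of row vectors. -/
def matrixBound (β : ℕ → ℕ → ℕ) : ℕ → ℕ → ℕ → ℕ
  | 0, r, _ => r
  | m + 1, r, D => β r D + matrixBound β m (β r D) (D + β r D)

/-- A bound for the kernels of row vectors yields a bound for the kernels of matrices. -/
theorem exists_kerBounded_matrix (β : ℕ → ℕ → ℕ) : ∃ β' : ℕ → ℕ → ℕ → ℕ,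
    ∀ (σ K : Type*) [Field K],
      (∀ r D (v : Fin r → MvPolynomial σ K), (∀ j, (v j).totalDegree ≤ D) →
        KerBounded (fun (_ : Unit) j => v j) (β r D)) →
      ∀ m r D (A : Matrix (Fin m) (Fin r) (MvPolynomial σ K)), (∀ i j, (A i j).totalDegree ≤ D) →
        KerBounded A (β' m r D) := by
  refine ⟨matrixBound β, fun σ K _ hrow m => ?_⟩
  induction m with
  | zero =>
    intro r D A _
    refine KerBounded.of_fintype (α := Fin r) (fun a => Pi.single a 1) (by simp [matrixBound])
      (fun a l => ?_) (fun a => by ext1 i; exact i.elim0) fun x _ => ⟨x, ?_⟩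
    · by_cases h : l = a
      · subst h; simp
      · simp [Pi.single_eq_of_ne h]
    · exact pi_eq_sum_univ' x |>.trans (by simp)
  | succ m ih =>
    intro r D A hA
    have H := hrow r D (A 0) (hA 0)
    rw [matrixBound]
    generalize β r D = t at H ⊢
    obtain ⟨h, h1, h2, h3⟩ := H
    let A' : Matrix (Fin m) (Fin t) (MvPolynomial σ K) := fun i a => ∑ j, A i.succ j * h a j
    obtain ⟨g, g1, g2, g3⟩ := ih t (D + t) A' (fun i a =>
      MvPolynomial.totalDegree_finsetSum_le fun j _ => (totalDegree_mul _ _).trans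
        (add_le_add (hA _ _) (h1 _ _)))
    have h2' : ∀ a, ∑ j, A 0 j * h a j = 0 := fun a => congrFun (h2 a) ()
    have comb : ∀ (c : Fin t → MvPolynomial σ K) i,
        ∑ j, A i j * (∑ a, c a • h a) j = ∑ a, (∑ j, A i j * h a j) * c a := by
      intro c i
      simp only [Finset.sum_apply, Pi.smul_apply, smul_eq_mul, Finset.mul_sum, Finset.sum_mul]
      rw [Finset.sum_comm]
      exact Finset.sum_congr rfl fun a _ => Finset.sum_congr rfl fun j _ => by ring
    refine KerBounded.of_fintype (fun b : Fin (matrixBound β m t (D + t)) => ∑ a, g b a • h a) ?_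
      (fun b l => ?_) (fun b => ?_) fun x hx => ?_
    · simp only [Fintype.card_fin]; exact Nat.le_add_left _ _
    · simp only [Finset.sum_apply, Pi.smul_apply, smul_eq_mul]
      refine MvPolynomial.totalDegree_finsetSum_le fun j _ => (totalDegree_mul _ _).trans ?_
      rw [add_comm]
      exact add_le_add (h1 _ _) (g1 _ _)
    · ext1 i
      change ∑ j, A i j * (∑ a, g b a • h a) j = 0
      rw [comb]
      refine Fin.cases ?_ (fun i => ?_) i
      · simp [h2']
      · exact congrFun (g2 b) i
    · obtain ⟨c, hc⟩ := h3 x (by ext1; exact congrFun hx 0)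
      obtain ⟨c', hc'⟩ := g3 c (by
        ext1 i
        have := congrFun hx i.succ
        change ∑ j, A i.succ j * x j = 0 at this
        rw [hc, comb] at this
        exact this)
      refine ⟨c', ?_⟩
      rw [hc, hc']
      simp only [Finset.sum_apply, Pi.smul_apply, smul_eq_mul, Finset.sum_smul, Finset.smul_sum,
        smul_smul]
      rw [Finset.sum_comm]

end BoundedKernels

section Shear

open MvPolynomial

variable {K : Type*} [Field K] {n : ℕ}

/-- The linear change of coordinates fixing `X 0` and mapping `X (j + 1)` to
`X (j + 1) + a j * X 0`. -/
noncomputable def shear (a : Fin n → K) :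
    MvPolynomial (Fin (n + 1)) K →ₐ[K] MvPolynomial (Fin (n + 1)) K :=
  aeval (Fin.cons (X 0) fun j => X j.succ + C (a j) * X 0)

theorem shear_X_zero (a : Fin n → K) : shear a (X 0) = X 0 := by simp [shear]

theorem shear_X_succ (a : Fin n → K) (j : Fin n) :
    shear a (X j.succ) = X j.succ + C (a j) * X 0 := by simp [shear]

theorem shear_neg_shear (a : Fin n → K) (f : MvPolynomial (Fin (n + 1)) K) :
    shear (-a) (shear a f) = f := by
  suffices (shear (-a)).comp (shear a) = AlgHom.id K _ from DFunLike.congr_fun this f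
  refine algHom_ext fun j => Fin.cases ?_ (fun j => ?_) j
  · simp [shear_X_zero]
  · simp only [AlgHom.comp_apply, shear_X_succ, map_add, map_mul, shear_X_zero, algHom_C,
      algebraMap_eq, Pi.neg_apply, map_neg, AlgHom.id_apply]
    ring

theorem MvPolynomial.totalDegree_aeval_le {σ τ : Type*} (z : σ → MvPolynomial τ K)
    {e : ℕ} (hz : ∀ i, (z i).totalDegree ≤ e) (f : MvPolynomial σ K) :
    (aeval z f).totalDegree ≤ f.totalDegree * e := by
  rw [aeval_def, eval₂_eq]
  refine totalDegree_finsetSum_le fun s hs => (totalDegree_mul _ _).trans ?_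
  rw [algebraMap_eq, totalDegree_C, zero_add]
  refine (totalDegree_finsetProd _ _).trans (le_trans ?_
    (Nat.mul_le_mul_right e (le_totalDegree hs)))
  rw [Finsupp.sum, Finset.sum_mul]
  exact Finset.sum_le_sum fun i _ => (totalDegree_pow _ _).trans
    (Nat.mul_le_mul_left (s i) (hz i))

theorem totalDegree_shear_le (a : Fin n → K) (f : MvPolynomial (Fin (n + 1)) K) :
    (shear a f).totalDegree ≤ f.totalDegree := by
  refine (totalDegree_aeval_le (e := 1) _ (fun j => Fin.cases ?_ (fun j => ?_) j) f).trans_eq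
    (mul_one _)
  · simp
  · simp only [Fin.cons_succ]
    refine (totalDegree_add _ _).trans (max_le (by simp) ((totalDegree_mul _ _).trans (by simp)))

theorem MvPolynomial.IsHomogeneous.shear {f : MvPolynomial (Fin (n + 1)) K} {d : ℕ}
    (hf : f.IsHomogeneous d) (a : Fin n → K) : (shear a f).IsHomogeneous d := by
  have := hf.aeval (n := 1) (Fin.cons (X 0) fun j => X j.succ + C (a j) * X 0)
    (fun j => Fin.cases (by simpa using isHomogeneous_X _ _)
      (fun j => by simpa using (isHomogeneous_X _ _).add (isHomogeneous_C_mul_X _ _)) j)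
  simpa [_root_.shear] using this

theorem MvPolynomial.coeff_aeval_C_mul_X {σ : Type*} (x : σ → K) (f : MvPolynomial σ K) (k : ℕ) :
    (aeval (fun j => Polynomial.C (x j) * Polynomial.X) f).coeff k =
      eval x (homogeneousComponent k f) := by
  induction f using MvPolynomial.induction_on' with
  | add p q hp hq => simp [hp, hq]
  | monomial s c =>
    have h1 : aeval (fun j => Polynomial.C (x j) * Polynomial.X) (monomial s c) =
        Polynomial.C (eval x (monomial s c)) * Polynomial.X ^ s.degree := by
      simp [aeval_monomial, eval_monomial, mul_pow, Finsupp.prod, Finset.prod_mul_distrib,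
        Finset.prod_pow_eq_pow_sum, Finsupp.degree_apply, mul_assoc]
    rw [h1, Polynomial.coeff_C_mul_X_pow]
    split_ifs with h
    · rw [homogeneousComponent_eq_self (isHomogeneous_monomial c h.symm)]
    · rw [homogeneousComponent_of_mem (isHomogeneous_monomial c rfl),
        if_neg (by simpa using h), map_zero]

theorem MvPolynomial.homogeneousComponent_totalDegree_ne_zero {σ : Type*} {f : MvPolynomial σ K}
    (hf : f ≠ 0) : homogeneousComponent f.totalDegree f ≠ 0 := by
  obtain ⟨s, hs, hsD⟩ := Finset.exists_mem_eq_sup f.support (support_nonempty.2 hf)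
    fun s => s.sum fun _ e => e
  intro h
  have := congrArg (coeff s) h
  rw [coeff_homogeneousComponent, if_pos (by rw [totalDegree, hsD]; rfl), coeff_zero] at this
  exact mem_support_iff.1 hs this

/-- Over an infinite field, every nonzero polynomial becomes monic in `X 0`, up to a nonzero
scalar, after a linear change of coordinates. -/
theorem exists_shear_coeff_eq_C [Infinite K] {f : MvPolynomial (Fin (n + 1)) K} (hf : f ≠ 0) :
    ∃ (a : Fin n → K) (u : K), u ≠ 0 ∧
      (finSuccEquiv K n (shear a f)).coeff f.totalDegree = C u := by
  set D := f.totalDegree with hD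
  have hF : homogeneousComponent D f ≠ 0 := homogeneousComponent_totalDegree_ne_zero hf
  obtain ⟨x, hx⟩ : ∃ x, eval x (X 0 * homogeneousComponent D f) ≠ 0 := by
    by_contra! h
    exact mul_ne_zero (X_ne_zero 0) hF (MvPolynomial.funext (by simpa using h))
  simp only [map_mul, eval_X, ne_eq, mul_eq_zero, not_or] at hx
  let a : Fin n → K := fun j => x j.succ / x 0
  set p := finSuccEquiv K n (shear a f) with hp
  let ε : MvPolynomial (Fin n) K →ₐ[K] K := aeval fun _ => 0
  let y : Fin (n + 1) → K := Fin.cons 1 a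
  have h1 : p.map (ε : MvPolynomial (Fin n) K →+* K) =
      aeval (fun j => Polynomial.C (y j) * Polynomial.X) f := by
    let φ : MvPolynomial (Fin (n + 1)) K →ₐ[K] Polynomial K :=
      ((Polynomial.mapAlgHom ε).comp (finSuccEquiv K n).toAlgHom).comp (shear a)
    suffices φ = aeval (fun j => Polynomial.C (y j) * Polynomial.X) from DFunLike.congr_fun this f
    refine algHom_ext fun j => Fin.cases ?_ (fun j => ?_) j
    · simp [φ, y, shear_X_zero, finSuccEquiv_X_zero]
    · simp [φ, y, ε, shear_X_succ, finSuccEquiv_apply]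
  have h2 : eval y (homogeneousComponent D f) ≠ 0 := by
    have hxy : x = fun j => x 0 * y j := by
      funext j
      refine Fin.cases ?_ (fun j => ?_) j
      · simp [y]
      · simp only [y, Fin.cons_succ, a]
        field_simp [hx.1]
    intro h
    apply hx.2
    rw [← coeff_aeval_C_mul_X] at h ⊢
    have h3 : ((Polynomial.aeval (Polynomial.C (x 0) * Polynomial.X)).comp
        (aeval fun j => Polynomial.C (y j) * Polynomial.X)) f =
          aeval (fun j => Polynomial.C (x j) * Polynomial.X) f := by
      refine DFunLike.congr_fun (algHom_ext fun j => ?_) f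
      simp only [AlgHom.comp_apply, aeval_X, map_mul, Polynomial.aeval_X, Polynomial.aeval_C,
        Polynomial.algebraMap_eq, congrFun hxy j]
      ring
    rw [← h3, AlgHom.comp_apply, Polynomial.aeval_def, Polynomial.algebraMap_eq,
      ← Polynomial.comp, Polynomial.comp_C_mul_X_coeff, h, zero_mul]
  have h3 : ε (p.coeff D) ≠ 0 := by
    rw [← coeff_aeval_C_mul_X, ← h1] at h2
    simpa using h2
  have h4 : p.coeff D ≠ 0 := fun h => h3 (by simp [h])
  have h5 := totalDegree_coeff_finSuccEquiv_add_le _ _ h4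
  have h6 := totalDegree_shear_le a f
  have h7 : (p.coeff D).totalDegree = 0 := by rw [← hp] at h5; omega
  rw [totalDegree_eq_zero_iff_eq_C] at h7
  exact ⟨a, _, fun h => h4 (by rw [h7, h, C_0]), h7⟩

theorem natDegree_finSuccEquiv_le_totalDegree (f : MvPolynomial (Fin (n + 1)) K) :
    (finSuccEquiv K n f).natDegree ≤ f.totalDegree := by
  rw [natDegree_finSuccEquiv]
  exact degreeOf_le_totalDegree f 0

end Shear

section HermannBound

open MvPolynomial Matrix

theorem KerBounded.of_map {σ K m κ : Type*} [Field K] [Fintype κ]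
    {A : Matrix m κ (MvPolynomial σ K)} {t : ℕ} (φ ψ : MvPolynomial σ K →ₐ[K] MvPolynomial σ K)
    (hψφ : ∀ f, ψ (φ f) = f)
    (hψ : ∀ f, (ψ f).totalDegree ≤ f.totalDegree) (h : KerBounded (A.map φ) t) :
    KerBounded A t := by
  obtain ⟨h, h1, h2, h3⟩ := h
  refine ⟨fun a l => ψ (h a l), fun a l => (hψ _).trans (h1 a l), fun a => ?_, fun x hx => ?_⟩
  · ext1 i
    have := congrArg ψ (congrFun (h2 a) i)
    simpa [mulVec, dotProduct, hψφ] using this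
  · obtain ⟨c, hc⟩ := h3 (fun l => φ (x l)) (by
      ext1 i
      have := congrArg φ (congrFun hx i)
      simpa [mulVec, dotProduct] using this)
    refine ⟨fun a => ψ (c a), ?_⟩
    ext1 l
    have := congrArg ψ (congrFun hc l)
    simpa [hψφ] using this

theorem sum_mul_koszul {B ι : Type*} [CommRing B] [Fintype ι] [DecidableEq ι] (V : ι → B)
    (i j₀ : ι) : ∑ j, V j * (Pi.single i (V j₀) - Pi.single j₀ (V i) : ι → B) j = 0 := by
  simp [mul_sub, Pi.single_apply, mul_comm]

/-- Modulo the Koszul relations, the entries of a relation between polynomials of degree at most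
`D`, one of which is monic up to a unit, may be taken of degree at most `D`. -/
theorem Polynomial.exists_eq_koszul_add {B ι : Type*} [CommRing B] [IsDomain B] [Fintype ι]
    [DecidableEq ι] (V : ι → Polynomial B) {D : ℕ} (hV : ∀ j, (V j).natDegree ≤ D) (j₀ : ι) {w : B}
    (hw : (Polynomial.C w * V j₀).Monic) (x : ι → Polynomial B) (hx : ∑ j, V j * x j = 0) :
    ∃ (q : ι → Polynomial B) (c : ι × Fin (D + 1) → B),
      x = ∑ j, q j • (Pi.single j (V j₀) - Pi.single j₀ (V j)) +
        (fun j => ∑ b, Polynomial.C (c (j, b)) * Polynomial.X ^ (b : ℕ)) ∧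
      ∑ j, V j * ∑ b, Polynomial.C (c (j, b)) * Polynomial.X ^ (b : ℕ) = 0 := by
  set P := Polynomial.C w * V j₀ with hP
  let q : ι → Polynomial B := fun j => Polynomial.C w * (x j /ₘ P)
  let x' := x - ∑ j, q j • (Pi.single j (V j₀) - Pi.single j₀ (V j))
  have hxj : ∀ j, j ≠ j₀ → x' j = x j %ₘ P := by
    intro j hj
    rw [Polynomial.modByMonic_eq_sub_mul_div, hP]
    simp [x', q, Finset.sum_apply, hj, Pi.single_apply]
    ring
  have hV0 : V j₀ ≠ 0 := by
    intro h
    exact hw.ne_zero (by rw [hP, h, mul_zero])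
  have hw0 : w ≠ 0 := by
    intro h
    exact hw.ne_zero (by rw [hP, h, Polynomial.C_0, zero_mul])
  have hdegP : P.natDegree = (V j₀).natDegree := Polynomial.natDegree_C_mul hw0
  have hx' : ∑ j, V j * x' j = 0 := by
    have h1 : ∑ j, V j * (∑ i, q i • (Pi.single i (V j₀) - Pi.single j₀ (V i)) :
        ι → Polynomial B) j = 0 := by
      simp only [Finset.sum_apply, Finset.mul_sum, Pi.smul_apply, smul_eq_mul]
      rw [Finset.sum_comm]
      refine Finset.sum_eq_zero fun i _ => ?_
      simp_rw [mul_left_comm (V _) (q i), ← Finset.mul_sum]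
      rw [sum_mul_koszul, mul_zero]
    simp only [x', Pi.sub_apply, mul_sub, Finset.sum_sub_distrib, hx, h1, sub_zero]
  have hdeg : ∀ j, (x' j).natDegree < D + 1 := by
    have h1 : ∀ j, j ≠ j₀ → (x' j).natDegree ≤ (V j₀).natDegree := by
      intro j hj
      rw [hxj j hj, ← hdegP]
      exact Polynomial.natDegree_modByMonic_le _ hw
    intro j
    rw [Nat.lt_succ_iff]
    by_cases hj : j = j₀
    · subst hj
      by_cases h0 : x' j = 0
      · simp [h0]
      have h2 : V j * x' j = - ∑ i ∈ Finset.univ.erase j, V i * x' i := by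
        rw [eq_neg_iff_add_eq_zero,
          Finset.add_sum_erase _ (fun i => V i * x' i) (Finset.mem_univ j),
            hx']
      have h3 := congrArg Polynomial.natDegree h2
      rw [Polynomial.natDegree_mul hV0 h0, Polynomial.natDegree_neg] at h3
      have h4 : (∑ i ∈ Finset.univ.erase j, V i * x' i).natDegree ≤ D + (V j).natDegree :=
        Polynomial.natDegree_sum_le_of_forall_le _ _ fun i hi => Polynomial.natDegree_mul_le.trans
          (add_le_add (hV i) (h1 i (Finset.ne_of_mem_erase hi)))
      omega
    · exact (h1 j hj).trans (hV j₀)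
  refine ⟨q, fun p => (x' p.1).coeff p.2, ?_⟩
  have : (fun j => ∑ b : Fin (D + 1),
      Polynomial.C ((x' j).coeff b) * Polynomial.X ^ (b : ℕ)) = x' := by
    funext j
    rw [Fin.sum_univ_eq_sum_range fun b => Polynomial.C ((x' j).coeff b) * Polynomial.X ^ b]
    exact ((x' j).as_sum_range_C_mul_X_pow' (hdeg j)).symm
  refine ⟨by rw [this]; simp [x'], ?_⟩
  simp only [congrFun this, hx']

theorem finSuccEquiv_symm_C {K : Type*} [Field K] {s : ℕ} (f : MvPolynomial (Fin s) K) :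
    (finSuccEquiv K s).symm (Polynomial.C f) = rename Fin.succ f := by
  rw [AlgEquiv.symm_apply_eq]
  suffices (IsScalarTower.toAlgHom K _ (Polynomial (MvPolynomial (Fin s) K))) =
      (finSuccEquiv K s).toAlgHom.comp (rename Fin.succ) from DFunLike.congr_fun this f
  refine algHom_ext fun j => ?_
  simp [finSuccEquiv_X_succ]

theorem finSuccEquiv_symm_X {K : Type*} [Field K] {s : ℕ} :
    (finSuccEquiv K s).symm Polynomial.X = X 0 := by
  rw [AlgEquiv.symm_apply_eq, finSuccEquiv_X_zero]

theorem KerBounded.of_row_succ {K : Type*} [Field K] {s r D t : ℕ}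
    {v : Fin r → MvPolynomial (Fin (s + 1)) K} (hv : ∀ j, (v j).totalDegree ≤ D) (j₀ : Fin r)
    {u : K} (hu : u ≠ 0) (hvu : (finSuccEquiv K s (v j₀)).leadingCoeff = C u)
    (h : KerBounded (fun (n : Fin (D + D + 1)) (p : Fin r × Fin (D + 1)) =>
      (finSuccEquiv K s (v p.1) * Polynomial.X ^ (p.2 : ℕ)).coeff n) t) :
    KerBounded (fun (_ : Unit) j => v j) (r + t + D) := by
  obtain ⟨h, h1, h2, h3⟩ := h
  let V : Fin r → Polynomial (MvPolynomial (Fin s) K) := fun j => finSuccEquiv K s (v j)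
  have hV : ∀ j, (V j).natDegree ≤ D := fun j =>
    (natDegree_finSuccEquiv_le_totalDegree _).trans (hv j)
  let e := (finSuccEquiv K s).symm
  have heV : ∀ j, e (V j) = v j := fun j => (finSuccEquiv K s).symm_apply_apply _
  let Φ : (Fin r × Fin (D + 1) → MvPolynomial (Fin s) K) →
      Fin r → Polynomial (MvPolynomial (Fin s) K) :=
    fun c j => ∑ b, Polynomial.C (c (j, b)) * Polynomial.X ^ (b : ℕ)
  have hΦ : ∀ c, (∑ j, V j * Φ c j = 0 ↔ (fun (n : Fin (D + D + 1)) (p : Fin r × Fin (D + 1)) =>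
      (V p.1 * Polynomial.X ^ (p.2 : ℕ)).coeff n : Matrix _ _ _) *ᵥ c = 0) := by
    intro c
    have h4 : ∑ j, V j * Φ c j =
        ∑ p : Fin r × Fin (D + 1), Polynomial.C (c p) * (V p.1 * Polynomial.X ^ (p.2 : ℕ)) := by
      rw [Fintype.sum_prod_type]
      simp only [Φ, Finset.mul_sum]
      exact Finset.sum_congr rfl fun j _ => Finset.sum_congr rfl fun b _ => by ring
    have h5 : (∑ j, V j * Φ c j).natDegree < D + D + 1 := by
      rw [h4, Nat.lt_succ_iff]
      refine Polynomial.natDegree_sum_le_of_forall_le _ _ fun p _ => ?_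
      refine (Polynomial.natDegree_C_mul_le _ _).trans (Polynomial.natDegree_mul_le.trans ?_)
      have := hV p.1
      have := p.2.2
      rw [Polynomial.natDegree_X_pow]
      omega
    have h6 : ∀ n, (∑ j, V j * Φ c j).coeff n =
        ∑ p : Fin r × Fin (D + 1), (V p.1 * Polynomial.X ^ (p.2 : ℕ)).coeff n * c p := by
      intro n
      rw [h4, Polynomial.finsetSum_coeff]
      exact Finset.sum_congr rfl fun p _ => by rw [Polynomial.coeff_C_mul, mul_comm]
    constructor
    · intro h
      ext1 n
      rw [h] at h6
      exact (h6 n).symm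
    · intro h
      ext1 n
      by_cases hn : n < D + D + 1
      · rw [h6]; exact congrFun h ⟨n, hn⟩
      · rw [Polynomial.coeff_zero]
        exact Polynomial.coeff_eq_zero_of_natDegree_lt (by omega)
  refine KerBounded.of_fintype (α := Fin r ⊕ Fin t) (Sum.elim
    (fun i => Pi.single i (v j₀) - Pi.single j₀ (v i)) fun a j => e (Φ (h a) j))
    (by simp) ?_ ?_ fun x hx => ?_
  · rintro (i | a) l
    · refine (totalDegree_sub _ _).trans (max_le ?_ ?_)
      · rw [Pi.single_apply]
        split_ifs
        · exact (hv _).trans (Nat.le_add_left _ _)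
        · simp
      · rw [Pi.single_apply]
        split_ifs
        · exact (hv _).trans (Nat.le_add_left _ _)
        · simp
    · simp only [Sum.elim_inr, Φ, map_sum, map_mul, map_pow, e, finSuccEquiv_symm_C,
        finSuccEquiv_symm_X]
      refine totalDegree_finsetSum_le fun b _ => (totalDegree_mul _ _).trans ?_
      have h4 := totalDegree_rename_le Fin.succ (h a (l, b))
      have h5 := h1 a (l, b)
      have h6 := b.2
      rw [totalDegree_X_pow]
      omega
  · rintro (i | a)
    · ext1
      exact sum_mul_koszul v i j₀
    · ext1
      have := congrArg e ((hΦ (h a)).2 (h2 a))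
      rw [map_sum, map_zero] at this
      simp only [map_mul, heV] at this
      exact this
  · have hx0 : ∑ j, v j * x j = 0 := congrFun hx ()
    obtain ⟨q, c, hqc, hc⟩ := Polynomial.exists_eq_koszul_add V hV j₀ (w := C u⁻¹) (by
        rw [Polynomial.Monic, Polynomial.leadingCoeff_mul, Polynomial.leadingCoeff_C]
        simp only [V]
        rw [hvu, ← C_mul, inv_mul_cancel₀ hu, C_1])
      (fun j => finSuccEquiv K s (x j))
      (by simpa [V] using congrArg (finSuccEquiv K s) hx0)
    obtain ⟨a, rfl⟩ := h3 c ((hΦ c).1 hc)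
    refine ⟨Sum.elim (fun i => e (q i)) fun i => e (Polynomial.C (a i)), ?_⟩
    ext1 l
    have h4 := congrArg e (congrFun hqc l)
    simp only [e, AlgEquiv.symm_apply_apply] at h4
    rw [h4, Fintype.sum_sum_type]
    simp only [Pi.add_apply, Finset.sum_apply, Pi.smul_apply, smul_eq_mul, Sum.elim_inl,
      Sum.elim_inr, map_add, map_sum, map_mul, Pi.sub_apply, map_sub, Φ, Finset.mul_sum,
      Finset.sum_mul]
    congr 1
    · refine Finset.sum_congr rfl fun i _ => ?_
      have hs : ∀ (i j : Fin r) (y : Polynomial (MvPolynomial (Fin s) K)),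
          e ((Pi.single i y : Fin r → _) j) = (Pi.single i (e y) : Fin r → _) j := by
        intro i j y
        by_cases hij : j = i
        · subst hij; simp
        · simp [hij]
      change e _ * (e _ - e _) = _
      rw [hs, hs, heV, heV]
    · rw [Finset.sum_comm]
      exact Finset.sum_congr rfl fun i _ => Finset.sum_congr rfl fun b _ => by ring

theorem KerBounded.mono {σ K m κ : Type*} [Field K] [Fintype κ]
    {A : Matrix m κ (MvPolynomial σ K)} {t t' : ℕ} (h : KerBounded A t) (ht : t ≤ t') :
    KerBounded A t' := by
  obtain ⟨h, h1, h2, h3⟩ := h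
  exact KerBounded.of_fintype h (by simpa using ht) (fun a l => (h1 a l).trans ht) h2 h3

theorem KerBounded.of_row_zero {σ K : Type*} [Field K] {r t : ℕ} (ht : r ≤ t) :
    KerBounded (fun (_ : Unit) (_ : Fin r) => (0 : MvPolynomial σ K)) t := by
  classical
  refine KerBounded.of_fintype (fun a : Fin r => Pi.single a 1) (by simpa using ht)
    (fun a l => ?_) (fun a => by ext1 i; simp [mulVec, dotProduct]) fun x _ => ⟨x, ?_⟩
  · by_cases h : l = a
    · subst h; simp
    · simp [Pi.single_eq_of_ne h]
  · exact pi_eq_sum_univ' x |>.trans (by simp)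

theorem KerBounded.of_row_unit {σ K : Type*} [Field K] {r D t : ℕ} (v : Fin r → MvPolynomial σ K)
    (hv : ∀ j, (v j).totalDegree ≤ D) (j₀ : Fin r) {u : K} (hu : u ≠ 0) (hvu : v j₀ = C u)
    (ht : r + D ≤ t) : KerBounded (fun (_ : Unit) j => v j) t := by
  classical
  refine KerBounded.of_fintype (fun i : Fin r => Pi.single i (v j₀) - Pi.single j₀ (v i))
    (by simp; omega) (fun i l => ?_) (fun i => ?_) fun x hx => ⟨fun i => C u⁻¹ * x i, ?_⟩
  · refine (totalDegree_sub _ _).trans (max_le ?_ ?_)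
    · rw [Pi.single_apply]
      split_ifs
      · exact (hv _).trans (by omega)
      · simp
    · rw [Pi.single_apply]
      split_ifs
      · exact (hv _).trans (by omega)
      · simp
  · ext1
    exact sum_mul_koszul v i j₀
  · have hx0 : ∑ j, v j * x j = 0 := congrFun hx ()
    have huu : C u⁻¹ * C u = (1 : MvPolynomial σ K) := by rw [← C_mul, inv_mul_cancel₀ hu, C_1]
    have h1 : ∑ i, C u⁻¹ * x i * v i = 0 := by
      rw [← mul_zero (C u⁻¹), ← hx0, Finset.mul_sum]
      exact Finset.sum_congr rfl fun i _ => by ring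
    ext1 l
    simp only [smul_sub, Finset.sum_sub_distrib, Pi.sub_apply, Finset.sum_apply, Pi.smul_apply,
      Pi.single_apply, smul_eq_mul, mul_ite, mul_zero, Finset.sum_ite_eq, Finset.mem_univ, if_true]
    by_cases hl : l = j₀
    · simp only [hl, if_true]
      rw [h1, sub_zero, hvu, mul_right_comm, huu, one_mul]
    · simp only [hl, if_false, Finset.sum_const_zero]
      rw [sub_zero, hvu, mul_right_comm, huu, one_mul]

/-- **Hermann's bound**: over an infinite field, the relations between `r` polynomials of degree at
most `D` in `s` variables are generated by a bounded number of relations of bounded degree. -/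
theorem exists_kerBounded_row (s : ℕ) : ∃ β : ℕ → ℕ → ℕ, ∀ (K : Type*) [Field K] [Infinite K],
    ∀ r D (v : Fin r → MvPolynomial (Fin s) K), (∀ j, (v j).totalDegree ≤ D) →
      KerBounded (fun (_ : Unit) j => v j) (β r D) := by
  induction s with
  | zero =>
    refine ⟨fun r D => r + D, fun K _ _ r D v hv => ?_⟩
    by_cases h : ∃ j, v j ≠ 0
    · obtain ⟨j₀, hj⟩ := h
      have h0 := eq_C_of_isEmpty (v j₀)
      exact KerBounded.of_row_unit v hv j₀ (fun h => hj (by rw [h0, h, C_0])) h0 le_rfl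
    · push Not at h
      simp only [h]
      exact KerBounded.of_row_zero (by omega)
  | succ s ih =>
    obtain ⟨β, hβ⟩ := ih
    obtain ⟨β', hβ'⟩ := exists_kerBounded_matrix β
    refine ⟨fun r D => r + β' (D + D + 1) (r * (D + 1)) D + D, fun K _ _ r D v hv => ?_⟩
    by_cases h : ∃ j, v j ≠ 0
    · obtain ⟨j₀, hj⟩ := h
      obtain ⟨a, u, hu, ha⟩ := exists_shear_coeff_eq_C hj
      refine KerBounded.of_map (shear a) (shear (-a)) (shear_neg_shear a)
        (totalDegree_shear_le _) ?_
      have hv' : ∀ j, (shear a (v j)).totalDegree ≤ D := fun j =>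
        (totalDegree_shear_le a _).trans (hv j)
      refine KerBounded.of_row_succ (v := fun j => shear a (v j)) hv' j₀ hu ?_ ?_
      · rw [← ha, Polynomial.leadingCoeff]
        congr 1
        refine le_antisymm ((natDegree_finSuccEquiv_le_totalDegree _).trans
          (totalDegree_shear_le a _)) (Polynomial.le_natDegree_of_ne_zero ?_)
        rw [ha]
        simpa using hu
      · refine KerBounded.of_reindex finProdFinEquiv.symm (hβ' (Fin s) K (hβ K) _ _ _ _ ?_)
        intro n p
        rw [Polynomial.coeff_mul_X_pow']
        split_ifs
        · set f := shear a (v (finProdFinEquiv.symm p).1) with hf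
          set k := (n : ℕ) - (finProdFinEquiv.symm p).2
          by_cases h0 : (finSuccEquiv K s f).coeff k = 0
          · simp [h0]
          · have := totalDegree_coeff_finSuccEquiv_add_le f k h0
            have := hv' (finProdFinEquiv.symm p).1
            exact (Nat.le_add_right _ _).trans (by assumption) |>.trans this
        · simp
    · push Not at h
      simp only [h]
      exact KerBounded.of_row_zero (by omega)

end HermannBound

section WeightFiltration

open MvPolynomial

variable {K ι : Type*} [Field K]

/-- The polynomials all of whose monomials have weight less than `w`. -/
noncomputable def weightLT (K : Type*) [Field K] {ι : Type*} (d : ι → ℕ) (w : ℕ) :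
    Submodule K (MvPolynomial ι K) :=
  restrictSupport K {m | Finsupp.weight d m < w}

variable {d : ι → ℕ}

theorem mem_weightLT {w : ℕ} {f : MvPolynomial ι K} :
    f ∈ weightLT K d w ↔ ∀ m, coeff m f ≠ 0 → Finsupp.weight d m < w := by
  simp [weightLT, mem_restrictSupport_iff, Set.subset_def]

theorem weightLT_mono {w w' : ℕ} (h : w ≤ w') : weightLT K d w ≤ weightLT K d w' :=
  restrictSupport_mono K fun _ hm => lt_of_lt_of_le hm h

theorem weightLT_zero {f : MvPolynomial ι K} (hf : f ∈ weightLT K d 0) : f = 0 := by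
  ext m
  by_contra h
  exact Nat.not_lt_zero _ (mem_weightLT.1 hf m h)

theorem mul_mem_weightLT {a b : ℕ} {f g : MvPolynomial ι K} (hf : f ∈ weightLT K d a)
    (hg : g ∈ weightLT K d (b + 1)) : f * g ∈ weightLT K d (a + b) := by
  classical
  rw [mem_weightLT] at *
  intro m hm
  rw [coeff_mul] at hm
  obtain ⟨x, hx, hne⟩ := Finset.exists_ne_zero_of_sum_ne_zero hm
  have h1 := hf _ (left_ne_zero_of_mul hne)
  have h2 := hg _ (right_ne_zero_of_mul hne)
  rw [← (Finset.HasAntidiagonal.mem_antidiagonal.1 hx), map_add]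
  omega

theorem X_mem_weightLT (v : ι) : (X v : MvPolynomial ι K) ∈ weightLT K d (d v + 1) := by
  simp [weightLT, X, Finsupp.weight_apply]

theorem C_mem_weightLT (c : K) : (C c : MvPolynomial ι K) ∈ weightLT K d 1 := by
  rw [C_apply, weightLT, monomial_mem_restrictSupport]; simp

theorem mem_weightLT_induction {P : ℕ → MvPolynomial ι K → Prop}
    (hC : ∀ c, P 0 (C c)) (hX : ∀ w f v, P w f → P (w + d v) (f * X v))
    (hadd : ∀ w f g, P w f → P w g → P w (f + g)) (hmono : ∀ w w' f, w ≤ w' → P w f → P w' f)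
    {w : ℕ} {f : MvPolynomial ι K} (hf : f ∈ weightLT K d (w + 1)) : P w f := by
  classical
  have hmul : ∀ m : ι →₀ ℕ, ∀ w f, P w f → P (w + Finsupp.weight d m) (f * monomial m 1) := by
    intro m
    induction m using Finsupp.induction_linear with
    | zero => intro w f h; simpa using h
    | add m m' h1 h2 =>
      intro w f h
      have := h2 _ _ (h1 _ _ h)
      rwa [mul_assoc, monomial_mul, mul_one, add_assoc, ← map_add] at this
    | single v n =>
      induction n with
      | zero => intro w f h; simpa using h
      | succ n ih =>
        intro w f h
        have := hX _ _ v (ih _ _ h)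
        rwa [mul_assoc, X, monomial_mul, mul_one, ← Finsupp.single_add, add_assoc,
          show d v = Finsupp.weight d (Finsupp.single v 1) by simp [Finsupp.weight_apply],
          ← map_add, ← Finsupp.single_add] at this
  have hmon : ∀ m : ι →₀ ℕ, ∀ c, P (Finsupp.weight d m) (monomial m c) := by
    intro m c
    simpa [C_mul_monomial] using hmul m 0 (C c) (hC c)
  rw [f.as_sum]
  rw [mem_weightLT] at hf
  have : ∀ s : Finset (ι →₀ ℕ), s ⊆ f.support → P w (∑ m ∈ s, monomial m (coeff m f)) := by
    intro s
    induction s using Finset.induction_on with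
    | empty =>
      intro _
      have := hmono 0 w _ (Nat.zero_le _) (hC 0)
      simpa using this
    | insert m s hm ih =>
      intro h
      rw [Finset.sum_insert hm]
      refine hadd _ _ _ (hmono _ _ _ (Nat.lt_succ_iff.1 (hf m ?_)) (hmon m _))
        (ih ((Finset.subset_insert _ _).trans h))
      exact mem_support_iff.1 (h (Finset.mem_insert_self _ _))
  exact this _ le_rfl

theorem aeval_X_add_sub_mem_weightLT {θ : ι → MvPolynomial ι K} (hθ : ∀ v, θ v ∈ weightLT K d (d v))
    {w : ℕ} {f : MvPolynomial ι K} (hf : f ∈ weightLT K d (w + 1)) :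
    aeval (fun v => X v + θ v) f - f ∈ weightLT K d w := by
  suffices f ∈ weightLT K d (w + 1) ∧ aeval (fun v => X v + θ v) f - f ∈ weightLT K d w from this.2
  refine mem_weightLT_induction (d := d)
    (P := fun w f => f ∈ weightLT K d (w + 1) ∧ aeval (fun v => X v + θ v) f - f ∈ weightLT K d w)
    (fun c => ?_) (fun w f v h => ?_) (fun w f g h1 h2 => ?_) (fun w w' f hw h => ?_) hf
  · exact ⟨by simpa using C_mem_weightLT c, by simp [← algebraMap_eq]⟩
  · refine ⟨by simpa [add_right_comm] using mul_mem_weightLT h.1 (X_mem_weightLT v), ?_⟩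
    rw [map_mul, aeval_X]
    have h1 : aeval (fun v => X v + θ v) f ∈ weightLT K d (w + 1) := by
      simpa using add_mem (weightLT_mono (Nat.le_succ w) h.2) h.1
    have h2 := mul_mem_weightLT h.2 (X_mem_weightLT v)
    have h3 := mul_mem_weightLT (hθ v) h1
    rw [add_comm (d v)] at h3
    convert add_mem h2 h3 using 1
    ring
  · refine ⟨add_mem h1.1 h2.1, ?_⟩
    rw [map_add, add_sub_add_comm]
    exact add_mem h1.2 h2.2
  · exact ⟨weightLT_mono (by omega) h.1, weightLT_mono hw h.2⟩

theorem mkDerivation_mem_weightLT {η : ι → MvPolynomial ι K} (hη : ∀ v, η v ∈ weightLT K d (d v))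
    {w : ℕ} {f : MvPolynomial ι K} (hf : f ∈ weightLT K d (w + 1)) :
    mkDerivation K η f ∈ weightLT K d w := by
  suffices f ∈ weightLT K d (w + 1) ∧ mkDerivation K η f ∈ weightLT K d w from this.2
  refine mem_weightLT_induction (d := d)
    (P := fun w f => f ∈ weightLT K d (w + 1) ∧ mkDerivation K η f ∈ weightLT K d w)
    (fun c => ?_) (fun w f v h => ?_) (fun w f g h1 h2 => ?_) (fun w w' f hw h => ?_) hf
  · exact ⟨by simpa using C_mem_weightLT c, by simp⟩
  · refine ⟨by simpa [add_right_comm] using mul_mem_weightLT h.1 (X_mem_weightLT v), ?_⟩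
    have h2 := mul_mem_weightLT h.2 (X_mem_weightLT v)
    have h3 := mul_mem_weightLT (hη v) h.1
    rw [add_comm (d v)] at h3
    rw [Derivation.leibniz, mkDerivation_X, smul_eq_mul, smul_eq_mul, mul_comm (X v),
      mul_comm f (η v)]
    exact add_mem h3 h2
  · refine ⟨add_mem h1.1 h2.1, ?_⟩
    rw [map_add]
    exact add_mem h1.2 h2.2
  · exact ⟨weightLT_mono (by omega) h.1, weightLT_mono hw h.2⟩

theorem mem_supported_of_mem_weightLT {w : ℕ} {f : MvPolynomial ι K} (hf : f ∈ weightLT K d w) :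
    f ∈ supported K {v | d v < w} := by
  rw [mem_supported]
  intro v hv
  obtain ⟨m, hm, hmv⟩ := (mem_vars_iff_mem_support v).1 hv
  exact (Finsupp.le_weight_of_ne_zero' d (Finsupp.mem_support_iff.1 hmv)).trans_lt
    (mem_weightLT.1 hf m (mem_support_iff.1 hm))

/-- The polynomials all of whose exponents are divisible by `p`. -/
noncomputable def dvdSupported (K ι : Type*) [Field K] (p : ℕ) :
    Submodule K (MvPolynomial ι K) :=
  restrictSupport K {m | ∀ v, p ∣ m v}

theorem mem_dvdSupported {p : ℕ} {f : MvPolynomial ι K} :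
    f ∈ dvdSupported K ι p ↔ ∀ m, coeff m f ≠ 0 → ∀ v, p ∣ m v := by
  simp [dvdSupported, mem_restrictSupport_iff, Set.subset_def]

theorem C_mem_dvdSupported (p : ℕ) (c : K) : (C c : MvPolynomial ι K) ∈ dvdSupported K ι p := by
  rw [C_apply, dvdSupported, monomial_mem_restrictSupport]
  simp

theorem pow_mem_dvdSupported {p : ℕ} [CharP K p] (hp : p.Prime) (g : MvPolynomial ι K) :
    g ^ p ∈ dvdSupported K ι p := by
  have := Fact.mk hp
  rw [g.as_sum, sum_pow_char p]
  refine sum_mem fun m _ => ?_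
  rw [monomial_pow, dvdSupported, monomial_mem_restrictSupport]
  left
  intro v
  simp

theorem eq_C_or_eq_pow_of_mem_dvdSupported {p : ℕ} [CharP K p]
    (hroot : p ≠ 0 → ∀ a : K, ∃ b, b ^ p = a) {f : MvPolynomial ι K}
    (hf : f ∈ dvdSupported K ι p) : (∃ c, f = C c) ∨
      p.Prime ∧ ∃ g, f = g ^ p ∧ ∀ m, coeff m g ≠ 0 → coeff (p • m) f ≠ 0 := by
  classical
  rw [mem_dvdSupported] at hf
  rcases CharP.char_is_prime_or_zero K p with hp | rfl
  · right
    have := Fact.mk hp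
    choose r hr using hroot hp.ne_zero
    have key : ∀ m ∈ f.support, ∃ m' : ι →₀ ℕ, m = p • m' := by
      intro m hm
      refine ⟨m.mapRange (· / p) (Nat.zero_div p), ?_⟩
      ext v
      simp [Nat.mul_div_cancel' (hf m (mem_support_iff.1 hm) v)]
    choose! q hq using key
    refine ⟨hp, ∑ m ∈ f.support, monomial (q m) (r (coeff m f)), ?_, fun m hm => ?_⟩
    · rw [sum_pow_char p]
      conv_lhs => rw [f.as_sum]
      refine Finset.sum_congr rfl fun m hm => ?_
      rw [monomial_pow, hr, ← hq m hm]
    · rw [coeff_sum] at hm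
      obtain ⟨n, hn, hne⟩ := Finset.exists_ne_zero_of_sum_ne_zero hm
      rw [coeff_monomial] at hne
      split_ifs at hne with h
      · rw [← h, ← hq n hn]
        exact mem_support_iff.1 hn
      · exact absurd rfl hne
  · left
    refine ⟨coeff 0 f, ?_⟩
    ext m
    rw [coeff_C]
    split_ifs with h
    · rw [h]
    · by_contra h2
      apply h
      ext v
      simpa using (zero_dvd_iff.1 (hf m h2 v)).symm

theorem aeval_mem_dvdSupported {p : ℕ} [CharP K p] (hroot : p ≠ 0 → ∀ a : K, ∃ b, b ^ p = a)
    (φ : MvPolynomial ι K →ₐ[K] MvPolynomial ι K) {f : MvPolynomial ι K}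
    (hf : f ∈ dvdSupported K ι p) : φ f ∈ dvdSupported K ι p := by
  rcases eq_C_or_eq_pow_of_mem_dvdSupported hroot hf with ⟨c, rfl⟩ | ⟨hp, g, rfl, -⟩
  · rw [← algebraMap_eq, AlgHom.commutes]
    exact C_mem_dvdSupported p c
  · rw [map_pow]
    exact pow_mem_dvdSupported hp _

theorem derivation_eq_zero_of_mem_dvdSupported {p : ℕ} [CharP K p]
    (hroot : p ≠ 0 → ∀ a : K, ∃ b, b ^ p = a)
    (D : Derivation K (MvPolynomial ι K) (MvPolynomial ι K)) {f : MvPolynomial ι K}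
    (hf : f ∈ dvdSupported K ι p) : D f = 0 := by
  rcases eq_C_or_eq_pow_of_mem_dvdSupported hroot hf with ⟨c, rfl⟩ | ⟨hp, g, rfl, -⟩
  · exact D.map_algebraMap c
  · rw [Derivation.leibniz_pow, ← Nat.cast_smul_eq_nsmul K, CharP.cast_eq_zero, zero_smul]

open Classical in
/-- A polynomial seen as a univariate polynomial in `X v`, with coefficients in the same ring. -/
noncomputable def expandAt (K : Type*) [Field K] {ι : Type*} (v : ι) :
    MvPolynomial ι K →ₐ[K] Polynomial (MvPolynomial ι K) :=
  aeval fun u => if u = v then Polynomial.X else Polynomial.C (X u)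

theorem expandAt_X_self (v : ι) : expandAt K v (X v) = Polynomial.X := by
  simp [expandAt]

theorem expandAt_of_mem_supported {v : ι} {f : MvPolynomial ι K}
    (hf : f ∈ supported K {u | u ≠ v}) : expandAt K v f = Polynomial.C f := by
  induction hf using Algebra.adjoin_induction with
  | mem x hx =>
    obtain ⟨u, hu, rfl⟩ := hx
    simp only [Set.mem_ofPred_eq] at hu
    simp [expandAt, hu]
  | algebraMap r => rw [AlgHom.commutes, Polynomial.algebraMap_apply]
  | add x y _ _ hx hy => rw [map_add, hx, hy, map_add]
  | mul x y _ _ hx hy => rw [map_mul, hx, hy, map_mul]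

theorem eval_expandAt (v : ι) (f : MvPolynomial ι K) : (expandAt K v f).eval (X v) = f := by
  induction f using MvPolynomial.induction_on with
  | C a => rw [← algebraMap_eq, AlgHom.commutes, Polynomial.algebraMap_apply, Polynomial.eval_C]
  | add p q hp hq => rw [map_add, Polynomial.eval_add, hp, hq]
  | mul_X p u hp =>
    rw [map_mul, Polynomial.eval_mul, hp, expandAt, aeval_X]
    split_ifs with h
    · rw [Polynomial.eval_X, h]
    · rw [Polynomial.eval_C]

open Classical in
theorem coeff_coeff_expandAt (v : ι) (f : MvPolynomial ι K) (k : ℕ) (m : ι →₀ ℕ) :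
    coeff m ((expandAt K v f).coeff k) =
      if m v = 0 then coeff (m + Finsupp.single v k) f else 0 := by
  have hmon : ∀ n c, expandAt K v (monomial n c) =
      Polynomial.C (monomial (n.erase v) c) * Polynomial.X ^ (n v) := by
    intro n c
    conv_lhs => rw [← Finsupp.erase_add_single v n, ← mul_one c, ← monomial_mul, map_mul]
    rw [← X_pow_eq_monomial, map_pow, expandAt_X_self, expandAt_of_mem_supported]
    rw [mem_supported]
    intro u hu
    obtain ⟨m, hm, hmu⟩ := (mem_vars_iff_mem_support u).1 hu
    rw [Finset.mem_singleton.1 (support_monomial_subset hm), Finsupp.support_erase] at hmu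
    exact (Finset.mem_erase.1 hmu).1
  induction f using MvPolynomial.induction_on' with
  | monomial n c =>
    have key : (n = m + Finsupp.single v k ∧ m v = 0) ↔ (k = n v ∧ n.erase v = m) := by
      constructor
      · rintro ⟨rfl, h⟩
        refine ⟨by simp [h], ?_⟩
        ext u
        by_cases hu : u = v
        · subst hu; simp [h]
        · simp [hu]
      · rintro ⟨rfl, rfl⟩
        exact ⟨(Finsupp.erase_add_single v n).symm, Finsupp.erase_same⟩
    rw [hmon, Polynomial.coeff_C_mul, Polynomial.coeff_X_pow, coeff_monomial]
    by_cases hk : k = n v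
    · rw [if_pos hk, mul_one, coeff_monomial]
      by_cases he : n.erase v = m
      · rw [if_pos he, if_pos (key.2 ⟨hk, he⟩).2, if_pos (key.2 ⟨hk, he⟩).1]
      · rw [if_neg he]
        split_ifs with h1 h2
        · exact absurd (key.1 ⟨h2, h1⟩).2 he
        · rfl
        · rfl
    · rw [if_neg hk, mul_zero, coeff_zero]
      split_ifs with h1 h2
      · exact absurd (key.1 ⟨h2, h1⟩).1 hk
      · rfl
      · rfl
  | add p q hp hq =>
    rw [map_add, Polynomial.coeff_add, coeff_add, hp, hq]
    split_ifs <;> simp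

theorem aeval_mem_supported {s t : Set ι} {g : ι → MvPolynomial ι K}
    (hg : ∀ u ∈ s, g u ∈ supported K t) {f : MvPolynomial ι K} (hf : f ∈ supported K s) :
    aeval g f ∈ supported K t := by
  induction hf using Algebra.adjoin_induction with
  | mem x hx =>
    obtain ⟨u, hu, rfl⟩ := hx
    rw [aeval_X]
    exact hg u hu
  | algebraMap r => rw [AlgHom.commutes]; exact algebraMap_mem _ _
  | add x y _ _ hx hy => rw [map_add]; exact add_mem hx hy
  | mul x y _ _ hx hy => rw [map_mul]; exact mul_mem hx hy

theorem mkDerivation_mem_supported {s t : Set ι} (hst : s ⊆ t) {g : ι → MvPolynomial ι K}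
    (hg : ∀ u ∈ s, g u ∈ supported K t) {f : MvPolynomial ι K} (hf : f ∈ supported K s) :
    mkDerivation K g f ∈ supported K t := by
  have hle : supported K s ≤ supported K t := supported_mono hst
  induction hf using Algebra.adjoin_induction with
  | mem x hx =>
    obtain ⟨u, hu, rfl⟩ := hx
    rw [mkDerivation_X]
    exact hg u hu
  | algebraMap r => rw [Derivation.map_algebraMap]; exact zero_mem _
  | add x y _ _ hx hy => rw [map_add]; exact add_mem hx hy
  | mul x y h1 h2 hx hy =>
    rw [Derivation.leibniz, smul_eq_mul, smul_eq_mul]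
    exact add_mem (mul_mem (hle h1) hy) (mul_mem (hle h2) hx)

section CharP

variable {J : Type*} {p : ℕ} [CharP K p] {θ η : J → ι → MvPolynomial ι K}

theorem coeff_expandAt_mem_supported {v : ι} {f : MvPolynomial ι K} {s : Set ι}
    (hf : f ∈ supported K s) (k : ℕ) :
    (expandAt K v f).coeff k ∈ supported K (s ∩ {u | u ≠ v}) := by
  classical
  rw [mem_supported] at *
  intro u hu
  obtain ⟨m, hm, hmu⟩ := (mem_vars_iff_mem_support u).1 hu
  rw [mem_support_iff, coeff_coeff_expandAt] at hm
  split_ifs at hm with h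
  · have huv : u ≠ v := by
      rintro rfl
      exact Finsupp.mem_support_iff.1 hmu h
    refine ⟨hf ((mem_vars_iff_mem_support u).2 ⟨_, mem_support_iff.2 hm, ?_⟩), huv⟩
    rw [Finsupp.mem_support_iff] at *
    simpa [huv.symm] using hmu
  · exact absurd rfl hm

theorem eq_sum_coeff_expandAt (v : ι) (f : MvPolynomial ι K) :
    f = ∑ k ∈ Finset.range ((expandAt K v f).natDegree + 1),
      (expandAt K v f).coeff k * X v ^ k := by
  conv_lhs => rw [← eval_expandAt v f, Polynomial.eval_eq_sum_range]

theorem expandAt_aeval_X_add {v : ι} {s : Set ι} (hsv : v ∉ s) {t : ι → MvPolynomial ι K}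
    (ht : ∀ u ∈ insert v s, t u ∈ supported K s) {f : MvPolynomial ι K}
    (hf : f ∈ supported K (insert v s)) :
    (expandAt K v (aeval (fun u => X u + t u) f)).coeff (expandAt K v f).natDegree =
      aeval (fun u => X u + t u) ((expandAt K v f).coeff (expandAt K v f).natDegree) := by
  have hsv' : s ⊆ {u | u ≠ v} := by
    rintro u hu rfl
    exact hsv hu
  have hc : ∀ k, aeval (fun u => X u + t u) ((expandAt K v f).coeff k) ∈
      supported K {u | u ≠ v} := by
    intro k
    refine aeval_mem_supported (fun u hu => ?_) (coeff_expandAt_mem_supported hf k)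
    exact add_mem (X_mem_supported.2 hu.2) (supported_mono hsv' (ht u hu.1))
  set e := (expandAt K v f).natDegree with he
  conv_lhs => rw [eq_sum_coeff_expandAt v f, ← he]
  simp only [map_sum, map_mul, map_pow, Polynomial.finsetSum_coeff, aeval_X, map_add,
    expandAt_X_self, expandAt_of_mem_supported (hc _), Polynomial.coeff_C_mul,
    expandAt_of_mem_supported (supported_mono hsv' (ht v (Set.mem_insert v s)))]
  rw [Finset.sum_range_succ, Finset.sum_eq_zero, zero_add]
  · simp [Polynomial.coeff_X_add_C_pow]
  · intro k hk
    rw [Polynomial.coeff_X_add_C_pow, Nat.choose_eq_zero_of_lt (Finset.mem_range.1 hk)]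
    simp

theorem expandAt_mkDerivation {v : ι} {s : Set ι} (hsv : v ∉ s) {t : ι → MvPolynomial ι K}
    (ht : ∀ u ∈ insert v s, t u ∈ supported K s) {f : MvPolynomial ι K}
    (hf : f ∈ supported K (insert v s)) (k : ℕ) :
    (expandAt K v (mkDerivation K t f)).coeff k =
      mkDerivation K t ((expandAt K v f).coeff k) +
        t v * ((expandAt K v f).coeff (k + 1) * (k + 1)) := by
  have hsv' : s ⊆ {u | u ≠ v} := by
    rintro u hu rfl
    exact hsv hu
  have hc : ∀ k, (expandAt K v f).coeff k ∈ supported K {u | u ≠ v} := fun k =>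
    supported_mono Set.inter_subset_right (coeff_expandAt_mem_supported hf k)
  have hc' : ∀ k, mkDerivation K t ((expandAt K v f).coeff k) ∈ supported K {u | u ≠ v} := by
    intro k
    refine mkDerivation_mem_supported Set.inter_subset_right (fun u hu => ?_)
      (coeff_expandAt_mem_supported hf k)
    exact supported_mono hsv' (ht u hu.1)
  have h1 : expandAt K v (mkDerivation K t f) =
      ∑ k ∈ Finset.range ((expandAt K v f).natDegree + 1),
        Polynomial.C (mkDerivation K t ((expandAt K v f).coeff k)) * Polynomial.X ^ k +
      Polynomial.C (t v) * Polynomial.derivative (expandAt K v f) := by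
    conv_rhs => enter [2, 2, 2]; rw [Polynomial.as_sum_range_C_mul_X_pow (expandAt K v f)]
    conv_lhs => rw [eq_sum_coeff_expandAt v f]
    rw [map_sum, map_sum, map_sum, Finset.mul_sum, ← Finset.sum_add_distrib]
    refine Finset.sum_congr rfl fun k _ => ?_
    rw [Derivation.leibniz, Derivation.leibniz_pow, mkDerivation_X]
    simp only [smul_eq_mul, nsmul_eq_mul, map_add, map_mul, map_pow, map_natCast,
      expandAt_X_self, expandAt_of_mem_supported (hc _), expandAt_of_mem_supported (hc' _),
      expandAt_of_mem_supported (supported_mono hsv' (ht v (Set.mem_insert v s))),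
      Polynomial.derivative_C_mul, Polynomial.derivative_X_pow]
    ring
  rw [h1, Polynomial.coeff_add, Polynomial.coeff_C_mul, Polynomial.coeff_derivative,
    Polynomial.finsetSum_coeff]
  congr 1
  simp only [Polynomial.coeff_C_mul_X_pow]
  rw [Finset.sum_ite_eq]
  split_ifs with h
  · rfl
  · rw [Polynomial.coeff_eq_zero_of_natDegree_lt, map_zero]
    simpa using h

theorem exists_dvdSupported_sub (p : ℕ) (f : MvPolynomial ι K) :
    ∃ g ∈ dvdSupported K ι p, (∀ m, coeff m (f - g) ≠ 0 → ¬ ∀ v, p ∣ m v) ∧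
      ∀ m, coeff m (f - g) ≠ 0 → coeff m f ≠ 0 := by
  classical
  have hc : ∀ m, coeff m (∑ n ∈ f.support with ∀ v, p ∣ n v, monomial n (coeff n f)) =
      if ∀ v, p ∣ m v then coeff m f else 0 := by
    intro m
    rw [coeff_sum]
    simp only [coeff_monomial]
    rw [Finset.sum_ite_eq']
    by_cases h : coeff m f = 0 <;> simp [h]
  refine ⟨∑ n ∈ f.support with ∀ v, p ∣ n v, monomial n (coeff n f), ?_, ?_, ?_⟩
  · rw [mem_dvdSupported]
    intro m hm
    rw [hc] at hm
    by_contra h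
    exact hm (if_neg h)
  · intro m hm h
    rw [coeff_sub, hc, if_pos h, sub_self] at hm
    exact hm rfl
  · intro m hm h
    rw [coeff_sub, hc, h, ite_self, sub_self] at hm
    exact hm rfl

theorem mem_dvdSupported_of_invariant (hd : ∀ v, 0 < d v)
    (hroot : p ≠ 0 → ∀ a : K, ∃ b, b ^ p = a)
    (hθ : ∀ j v, θ j v ∈ weightLT K d (d v)) (hη : ∀ j v, η j v ∈ weightLT K d (d v)) {w : ℕ}
    (hinv : ∀ a ∈ weightLT K d w, (∀ j, aeval (fun u => X u + θ j u) a = a) → ∃ c, a = C c)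
    (hlin : ∀ a, (∀ j, mkDerivation K (η j) a = 0) → ∀ v, coeff (Finsupp.single v 1) a = 0)
    (w' : ℕ) (hw' : w' ≤ w) (b : MvPolynomial ι K) (hb : b ∈ weightLT K d (w' + 1))
    (hDb : ∀ j, mkDerivation K (η j) b = 0)
    (hτb : ∀ j, aeval (fun u => X u + θ j u) b - b ∈ dvdSupported K ι p) :
    b ∈ dvdSupported K ι p := by
  classical
  induction w' using Nat.strong_induction_on generalizing b with
  | _ w' ih =>
  obtain ⟨g, hg, hbg, hbg'⟩ := exists_dvdSupported_sub p b
  obtain ⟨f, rfl⟩ : ∃ f, b = f + g := ⟨b - g, by ring⟩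
  rw [add_sub_cancel_right] at hbg hbg'
  replace hDb : ∀ j, mkDerivation K (η j) f = 0 := by
    intro j
    have := hDb j
    rwa [map_add, derivation_eq_zero_of_mem_dvdSupported hroot _ hg, add_zero] at this
  replace hτb : ∀ j, aeval (fun u => X u + θ j u) f - f ∈ dvdSupported K ι p := by
    intro j
    have := sub_mem (hτb j) (sub_mem (aeval_mem_dvdSupported hroot
      (aeval (fun u => X u + θ j u)) hg) hg)
    rw [map_add] at this
    convert this using 1
    ring
  have hf : f ∈ weightLT K d (w' + 1) :=
    mem_weightLT.2 fun m hm => mem_weightLT.1 hb m (hbg' m hm)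
  suffices f = 0 by rwa [this, zero_add]
  by_contra hf0
  obtain ⟨m₀, hm₀⟩ := ne_zero_iff.1 hf0
  have hvars : f.vars.Nonempty := by
    have := hbg m₀ hm₀
    push Not at this
    obtain ⟨v, hv⟩ := this
    refine ⟨v, (mem_vars_iff_mem_support v).2 ⟨m₀, mem_support_iff.2 hm₀, ?_⟩⟩
    rw [Finsupp.mem_support_iff]
    intro h
    simp [h] at hv
  obtain ⟨v, hv, hmax⟩ := Finset.exists_max_image f.vars d hvars
  set s : Set ι := {u | d u ≤ d v ∧ u ≠ v} with hs
  have hvs : v ∉ s := fun h => h.2 rfl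
  have hsup : ∀ t : ι → MvPolynomial ι K, (∀ u, t u ∈ weightLT K d (d u)) →
      ∀ u ∈ insert v s, t u ∈ supported K s := by
    intro t ht u hu
    refine supported_mono ?_ (mem_supported_of_mem_weightLT (ht u))
    have hu' : d u ≤ d v := by
      rcases hu with rfl | hu
      · exact le_rfl
      · exact hu.1
    intro u' hu''
    have h3 : d u' < d v := lt_of_lt_of_le hu'' hu'
    refine ⟨h3.le, ?_⟩
    rintro rfl
    exact lt_irrefl _ h3
  have hfs : f ∈ supported K (insert v s) := by
    rw [mem_supported]
    intro u hu
    by_cases h : u = v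
    · exact Or.inl h
    · exact Or.inr ⟨hmax u hu, h⟩
  set e := (expandAt K v f).natDegree with he
  set a := (expandAt K v f).coeff e with ha
  have he0 : 0 < e := by
    obtain ⟨m, hm, hmv⟩ := (mem_vars_iff_mem_support v).1 hv
    refine lt_of_lt_of_le (Nat.pos_of_ne_zero (Finsupp.mem_support_iff.1 hmv))
      (Polynomial.le_natDegree_of_ne_zero (n := m v) fun h => ?_)
    have := coeff_coeff_expandAt v f (m v) (m.erase v)
    rw [h, coeff_zero, Finsupp.erase_same, if_pos rfl, Finsupp.erase_add_single] at this
    exact mem_support_iff.1 hm this.symm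
  have ha0 : a ≠ 0 := by
    rw [ha, he, Polynomial.coeff_natDegree, Ne, Polynomial.leadingCoeff_eq_zero]
    intro h
    rw [h, Polynomial.natDegree_zero] at he
    omega
  have hcoeff : ∀ m, coeff m a ≠ 0 → m v = 0 ∧ coeff (m + Finsupp.single v e) f ≠ 0 := by
    intro m hm
    rw [ha, coeff_coeff_expandAt] at hm
    split_ifs at hm with h
    · exact ⟨h, hm⟩
    · exact absurd rfl hm
  have haw : a ∈ weightLT K d w' := by
    rw [mem_weightLT]
    intro m hm
    have h1 := mem_weightLT.1 hf _ (hcoeff m hm).2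
    rw [map_add, Finsupp.weight_single, smul_eq_mul] at h1
    have h2 := Nat.mul_le_mul he0 (hd v)
    omega
  have hw0 : 0 < w' := by
    rcases Nat.eq_zero_or_pos w' with rfl | h
    · exact absurd (weightLT_zero haw) ha0
    · exact h
  have hτa : ∀ j m, coeff m (aeval (fun u => X u + θ j u) a - a) ≠ 0 →
      ∀ u, p ∣ (m + Finsupp.single v e) u := by
    intro j m hm
    have h1 := expandAt_aeval_X_add hvs (hsup _ (hθ j)) hfs
    rw [← he, ← ha] at h1
    have h2 := coeff_coeff_expandAt v (aeval (fun u => X u + θ j u) f - f) e m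
    rw [map_sub, Polynomial.coeff_sub, h1, ← ha] at h2
    rw [h2] at hm
    split_ifs at hm
    · exact mem_dvdSupported.1 (hτb j) _ hm
    · exact absurd rfl hm
  by_cases hpe : p ∣ e
  · have hZ : a ∈ dvdSupported K ι p := by
      refine ih (w' - 1) (by omega) (by omega) a (by rwa [Nat.sub_add_cancel hw0]) ?_ ?_
      · intro j
        have h1 := expandAt_mkDerivation hvs (hsup _ (hη j)) hfs e
        rw [hDb, map_zero, Polynomial.coeff_zero,
          Polynomial.coeff_eq_zero_of_natDegree_lt (Nat.lt_succ_self e)] at h1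
        simpa using h1.symm
      · intro j
        rw [mem_dvdSupported]
        intro m hm u
        have h1 := hτa j m hm u
        rw [Finsupp.add_apply] at h1
        refine (Nat.dvd_add_left ?_).1 h1
        rw [Finsupp.single_apply]
        split_ifs
        · exact hpe
        · exact dvd_zero p
    obtain ⟨m, hm⟩ := ne_zero_iff.1 ha0
    refine hbg _ (hcoeff m hm).2 fun u => ?_
    rw [Finsupp.add_apply]
    refine dvd_add (mem_dvdSupported.1 hZ m hm u) ?_
    rw [Finsupp.single_apply]
    split_ifs
    · exact hpe
    · exact dvd_zero p
  · obtain ⟨c, hc⟩ := hinv a (weightLT_mono hw' haw) fun j => by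
      rw [← sub_eq_zero]
      by_contra h
      obtain ⟨m, hm⟩ := ne_zero_iff.1 h
      have hmv : m v = 0 := by
        have h1 := expandAt_aeval_X_add hvs (hsup _ (hθ j)) hfs
        rw [← he, ← ha] at h1
        have h2 := coeff_coeff_expandAt v (aeval (fun u => X u + θ j u) f - f) e m
        rw [map_sub, Polynomial.coeff_sub, h1, ← ha] at h2
        rw [h2] at hm
        split_ifs at hm with h3
        · exact h3
        · exact absurd rfl hm
      have h1 := hτa j m hm v
      rw [Finsupp.add_apply, hmv, zero_add, Finsupp.single_eq_same] at h1
      exact hpe h1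
    have hc0 : c ≠ 0 := by
      rintro rfl
      exact ha0 (by rw [hc, map_zero])
    clear_value a e
    obtain ⟨e', rfl⟩ : ∃ e', e = e' + 1 := ⟨e - 1, by omega⟩
    have h2 := hlin ((expandAt K v f).coeff e' + C (c * ((e' + 1 : ℕ) : K)) * X v) (fun j => by
      have h1 := expandAt_mkDerivation hvs (hsup _ (hη j)) hfs e'
      rw [hDb, map_zero, Polynomial.coeff_zero, ← ha, hc] at h1
      rw [map_add, Derivation.leibniz, mkDerivation_X, derivation_C]
      simp only [smul_eq_mul, map_mul, map_natCast]
      push_cast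
      linear_combination h1.symm) v
    rw [coeff_add, coeff_coeff_expandAt, if_neg (by simp), zero_add,
          coeff_C_mul, coeff_X, if_pos rfl, mul_one]
      at h2
    rcases mul_eq_zero.1 h2 with h3 | h3
    · exact hc0 h3
    · exact hpe ((CharP.cast_eq_zero_iff K p _).1 h3)

end CharP

theorem injective_aeval_of_invariant {J : Type*} {p : ℕ} [CharP K p] {A : Type*} [CommRing A]
    [IsReduced A] [Nontrivial A] [Algebra K A] (hroot : p ≠ 0 → ∀ a : K, ∃ b, b ^ p = a)
    (hd : ∀ v, 0 < d v) {y : ι → A} (τ : J → A →ₐ[K] A) (D : J → Derivation K A A)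
    {θ η : J → ι → MvPolynomial ι K}
    (hθ : ∀ j v, θ j v ∈ weightLT K d (d v)) (hη : ∀ j v, η j v ∈ weightLT K d (d v))
    (hτ : ∀ j v, aeval y (θ j v) = τ j (y v) - y v) (hD : ∀ j v, aeval y (η j v) = D j (y v))
    (hlin : ∀ f : MvPolynomial ι K, (∀ j, D j (aeval y f) = 0) →
      ∀ v, coeff (Finsupp.single v 1) f = 0)
    (hinv : ∀ f : MvPolynomial ι K, (∀ j, τ j (aeval y f) = aeval y f) →
      ∃ c, aeval y f = algebraMap K A c) :
    AlgebraicIndependent K y := by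
  have hτ' : ∀ j (f : MvPolynomial ι K),
      aeval y (aeval (fun u => X u + θ j u) f) = τ j (aeval y f) := by
    intro j f
    have : (aeval y : MvPolynomial ι K →ₐ[K] A).comp (aeval (fun u => X u + θ j u)) =
        (τ j).comp (aeval y) := by
      ext v
      simp [hτ]
    exact DFunLike.congr_fun this f
  have hD' : ∀ j (f : MvPolynomial ι K), aeval y (mkDerivation K (η j) f) = D j (aeval y f) := by
    intro j f
    induction f using MvPolynomial.induction_on with
    | C a => simp [← algebraMap_eq]
    | add p q hp hq => simp only [map_add, hp, hq]
    | mul_X p v hp =>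
      rw [Derivation.leibniz, mkDerivation_X, map_mul, Derivation.leibniz]
      simp [hp, hD]
  have main : ∀ w, ∀ f ∈ weightLT K d (w + 1), aeval y f = 0 → f = 0 := by
    intro w
    induction w with
    | zero =>
      intro f hf h
      have hf' : f = C (coeff 0 f) := by
        classical
        ext m
        rw [coeff_C]
        split_ifs with h0
        · rw [h0]
        · by_contra hm
          obtain ⟨v, hv⟩ := Finsupp.ne_iff.1 (Ne.symm h0)
          have h1 := mem_weightLT.1 hf m hm
          have h2 := Finsupp.le_weight_of_ne_zero' d hv
          have := hd v
          omega
      rw [hf', ← algebraMap_eq, AlgHom.commutes] at h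
      rw [hf', (algebraMap K A).injective (h.trans (map_zero _).symm), map_zero]
    | succ w ih =>
      intro f hf h
      have hZ : f ∈ dvdSupported K ι p := by
        refine mem_dvdSupported_of_invariant (θ := θ) (η := η) hd hroot hθ hη (w := w + 1) ?_ ?_
          (w + 1) le_rfl f hf ?_ ?_
        · intro a ha h1
          obtain ⟨c, hc⟩ := hinv a fun j => by rw [← hτ', h1]
          refine ⟨c, sub_eq_zero.1 (ih _ (sub_mem ha (weightLT_mono (by omega)
            (C_mem_weightLT c))) ?_)⟩
          rw [map_sub, hc, ← algebraMap_eq, AlgHom.commutes, sub_self]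
        · intro a h1
          exact hlin a fun j => by rw [← hD', h1, map_zero]
        · intro j
          refine ih _ (mkDerivation_mem_weightLT (hη j) hf) ?_
          rw [hD', h, map_zero]
        · intro j
          rw [ih _ (aeval_X_add_sub_mem_weightLT (hθ j) hf) ?_]
          · exact zero_mem _
          · rw [map_sub, hτ', h, map_zero, sub_zero]
      rcases eq_C_or_eq_pow_of_mem_dvdSupported hroot hZ with ⟨c, rfl⟩ | ⟨hp, g, rfl, hg⟩
      · exact ih _ (weightLT_mono (by omega) (C_mem_weightLT c)) h
      · have hg' : g ∈ weightLT K d (w + 1) := by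
          rw [mem_weightLT] at hf ⊢
          intro m hm
          have h1 := hf _ (hg m hm)
          rw [map_nsmul, smul_eq_mul] at h1
          have := hp.two_le
          nlinarith
        rw [map_pow] at h
        rw [ih g hg' (eq_zero_of_pow_eq_zero h), zero_pow hp.ne_zero]
  rw [AlgebraicIndependent, injective_iff_map_eq_zero]
  intro f h
  refine main (f.support.sup (Finsupp.weight d)) f (mem_weightLT.2 fun m hm => ?_) h
  exact Nat.lt_succ_of_le (Finset.le_sup (f := Finsupp.weight d) (mem_support_iff.2 hm))

end WeightFiltration

section GradedAlgebra

open MvPolynomial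

variable {K : Type*} {A : Type v} [Field K] [CommRing A] [Algebra K A]

/-- The span of the products of two elements of positive degree, of total degree `n`. -/
def decomposables (𝒜 : ℕ → Submodule K A) (n : ℕ) : Submodule K A :=
  Submodule.span K {x | ∃ k l a b, 0 < k ∧ 0 < l ∧ k + l = n ∧ a ∈ 𝒜 k ∧ b ∈ 𝒜 l ∧ x = a * b}

open Classical in
theorem exists_dual_basis_mod {V : Type*} [AddCommGroup V] [Module K V] (P D : Submodule K V) :
    ∃ (T : Set (P.map D.mkQ)) (y : T → V) (ℓ : T → V →ₗ[K] K), (∀ t, y t ∈ P) ∧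
      (∀ t, ∀ x ∈ D, ℓ t x = 0) ∧ (∀ t t', ℓ t (y t') = if t = t' then 1 else 0) ∧
      P ≤ Submodule.span K (Set.range y) ⊔ D := by
  let b := Module.Basis.ofVectorSpace K (P.map D.mkQ)
  have hy : ∀ t, ∃ y ∈ P, D.mkQ y = b t := fun t => (b t).2
  choose y hy hyb using hy
  have hℓ : ∀ t, ∃ g : (V ⧸ D) →ₗ[K] K, g ∘ₗ (P.map D.mkQ).subtype = b.coord t := fun t =>
    LinearMap.exists_extend _
  choose g hg using hℓ
  refine ⟨_, y, fun t => g t ∘ₗ D.mkQ, hy, fun t x hx => ?_, fun t t' => ?_, fun x hx => ?_⟩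
  · rw [LinearMap.comp_apply, Submodule.mkQ_apply, (Submodule.Quotient.mk_eq_zero D).2 hx, map_zero]
  · rw [LinearMap.comp_apply, hyb]
    have := LinearMap.congr_fun (hg t) (b t')
    rw [LinearMap.comp_apply, Submodule.subtype_apply] at this
    rw [this, Module.Basis.coord_apply, Module.Basis.repr_self, Finsupp.single_apply]
    simp only [eq_comm]
  · have h1 := b.mem_span ⟨D.mkQ x, Submodule.mem_map_of_mem hx⟩
    have h2 : D.mkQ x ∈ Submodule.span K (Set.range fun t => D.mkQ (y t)) := by
      have := Submodule.mem_map_of_mem (f := (P.map D.mkQ).subtype) h1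
      rw [Submodule.map_span, ← Set.range_comp] at this
      rwa [show (P.map D.mkQ).subtype ∘ b = fun t => D.mkQ (y t) from
        funext fun t => (hyb t).symm] at this
    rw [show (Set.range fun t => D.mkQ (y t)) = D.mkQ '' Set.range y by rw [← Set.range_comp]; rfl,
      ← Submodule.map_span] at h2
    obtain ⟨z, hz, hzx⟩ := h2
    have h3 : x - z ∈ D := by
      rw [← Submodule.ker_mkQ D, LinearMap.mem_ker, map_sub, hzx, sub_self]
    rw [← add_sub_cancel z x]
    exact add_mem (Submodule.mem_sup_left hz) (Submodule.mem_sup_right h3)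

variable {𝒜 : ℕ → Submodule K A} {ι : Type*} {d : ι → ℕ} {y : ι → A}

theorem aeval_monomial_mem_graded (hone : (1 : A) ∈ 𝒜 0)
    (hmul : ∀ k l a b, a ∈ 𝒜 k → b ∈ 𝒜 l → a * b ∈ 𝒜 (k + l)) (hy : ∀ v, y v ∈ 𝒜 (d v))
    (m : ι →₀ ℕ) (c : K) : aeval y (monomial m c) ∈ 𝒜 (Finsupp.weight d m) := by
  suffices h : ∀ m : ι →₀ ℕ, aeval y (monomial m (1 : K)) ∈ 𝒜 (Finsupp.weight d m) by
    have := (𝒜 (Finsupp.weight d m)).smul_mem c (h m)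
    rwa [← map_smul, smul_monomial, smul_eq_mul, mul_one] at this
  intro m
  induction m using Finsupp.induction_linear with
  | zero => simpa using hone
  | add f g hf hg =>
    rw [map_add, ← mul_one (1 : K), ← monomial_mul, map_mul]
    exact hmul _ _ _ _ hf hg
  | single v n =>
    induction n with
    | zero => simpa using hone
    | succ n ih =>
      rw [Finsupp.single_add, map_add, ← mul_one (1 : K), ← monomial_mul, map_mul]
      refine hmul _ _ _ _ ih ?_
      rw [← X, aeval_X, Finsupp.weight_single, one_smul]
      exact hy v

theorem aeval_mem_iSup_graded (hone : (1 : A) ∈ 𝒜 0)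
    (hmul : ∀ k l a b, a ∈ 𝒜 k → b ∈ 𝒜 l → a * b ∈ 𝒜 (k + l)) (hy : ∀ v, y v ∈ 𝒜 (d v))
    (f : MvPolynomial ι K) : aeval y f ∈ ⨆ n, 𝒜 n := by
  rw [f.as_sum, map_sum]
  exact sum_mem fun m _ =>
    Submodule.mem_iSup_of_mem _ (aeval_monomial_mem_graded hone hmul hy m _)

theorem graded_le_map_weightLT (hzero : ∀ f ∈ 𝒜 0, ∃ c, f = algebraMap K A c)
    (hspan : ∀ n, 0 < n → 𝒜 n ≤ Submodule.span K {x | ∃ v, d v = n ∧ x = y v} ⊔ decomposables 𝒜 n)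
    (n : ℕ) : 𝒜 n ≤ (weightLT K d (n + 1)).map (aeval y).toLinearMap := by
  induction n using Nat.strong_induction_on with
  | _ n ih =>
  rcases Nat.eq_zero_or_pos n with rfl | hn
  · intro f hf
    obtain ⟨c, rfl⟩ := hzero f hf
    exact ⟨C c, C_mem_weightLT c, by simp [← algebraMap_eq]⟩
  · refine (hspan n hn).trans (sup_le (Submodule.span_le.2 ?_) (Submodule.span_le.2 ?_))
    · rintro _ ⟨v, rfl, rfl⟩
      exact ⟨X v, X_mem_weightLT v, by simp⟩
    · rintro _ ⟨k, l, a, b, hk, hl, rfl, ha, hb, rfl⟩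
      obtain ⟨a', ha', rfl⟩ := ih k (by omega) ha
      obtain ⟨b', hb', rfl⟩ := ih l (by omega) hb
      refine ⟨a' * b', ?_, by simp⟩
      have := mul_mem_weightLT ha' hb'
      rwa [add_right_comm] at this

theorem aeval_monomial_mem_decomposables (hone : (1 : A) ∈ 𝒜 0)
    (hmul : ∀ k l a b, a ∈ 𝒜 k → b ∈ 𝒜 l → a * b ∈ 𝒜 (k + l)) (hd : ∀ v, 0 < d v)
    (hy : ∀ v, y v ∈ 𝒜 (d v)) {m : ι →₀ ℕ} (h0 : m ≠ 0) (hX : ∀ v, m ≠ Finsupp.single v 1)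
    (c : K) : aeval y (monomial m c) ∈ decomposables 𝒜 (Finsupp.weight d m) := by
  classical
  obtain ⟨v, hv⟩ := Finsupp.ne_iff.1 h0
  obtain ⟨m', rfl⟩ : ∃ m', m = Finsupp.single v 1 + m' := by
    refine ⟨m - Finsupp.single v 1, (add_tsub_cancel_of_le ?_).symm⟩
    rw [Finsupp.single_le_iff]
    exact Nat.one_le_iff_ne_zero.2 hv
  have h1 : m' ≠ 0 := by
    rintro rfl
    exact hX v (add_zero _)
  obtain ⟨u, hu⟩ := Finsupp.ne_iff.1 h1
  refine Submodule.subset_span ⟨d v, Finsupp.weight d m', y v,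
    aeval y (monomial m' c), hd v, ?_, ?_, hy v, aeval_monomial_mem_graded hone hmul hy m' c, ?_⟩
  · exact (hd u).trans_le (Finsupp.le_weight_of_ne_zero' d hu)
  · rw [map_add]; simp [Finsupp.weight_apply]
  · rw [← one_mul c, ← monomial_mul, map_mul, one_mul, ← X, aeval_X]

theorem exists_algebraicIndependent_of_graded {J : Type*} {p : ℕ} [CharP K p] [IsReduced A]
    [Nontrivial A] (hroot : p ≠ 0 → ∀ a : K, ∃ b, b ^ p = a) (hone : (1 : A) ∈ 𝒜 0)
    (hmul : ∀ k l a b, a ∈ 𝒜 k → b ∈ 𝒜 l → a * b ∈ 𝒜 (k + l))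
    (comp : ℕ → A →ₗ[K] A) (hcomp_mem : ∀ n f, comp n f ∈ 𝒜 n)
    (hcomp_self : ∀ n, ∀ f ∈ 𝒜 n, comp n f = f)
    (hcomp_ne : ∀ n m, n ≠ m → ∀ f ∈ 𝒜 n, comp m f = 0)
    (τ : J → A →ₐ[K] A) (hτ : ∀ j n, ∀ f ∈ 𝒜 n, τ j f - f ∈ ⨆ k < n, 𝒜 k)
    (D : J → Derivation K A A) (hD : ∀ j n, ∀ f ∈ 𝒜 (n + 1), D j f ∈ 𝒜 n)
    (hcompD : ∀ j n f, comp n (D j f) = D j (comp (n + 1) f))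
    (hdec : ∀ n, ∀ f ∈ 𝒜 (n + 1), (∀ j, D j f = 0) → f ∈ decomposables 𝒜 (n + 1))
    (hinv : ∀ f ∈ ⨆ n, 𝒜 n, (∀ j, τ j f = f) → ∃ c, f = algebraMap K A c) :
    ∃ (ι : Type v) (d : ι → ℕ) (y : ι → A), (∀ v, 0 < d v) ∧ (∀ v, y v ∈ 𝒜 (d v)) ∧
      AlgebraicIndependent K y ∧ ∀ n, ∀ f ∈ 𝒜 n, ∃ P, aeval (R := K) y P = f := by
  classical
  choose T Y ℓ hY hℓD hℓY hspan using fun n : ℕ =>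
    exists_dual_basis_mod (𝒜 (n + 1)) (decomposables 𝒜 (n + 1))
  let d : (Σ n, T n) → ℕ := fun v => v.1 + 1
  let y : (Σ n, T n) → A := fun v => Y v.1 v.2
  have hd : ∀ v, 0 < d v := fun v => Nat.succ_pos _
  have hy : ∀ v, y v ∈ 𝒜 (d v) := fun v => hY v.1 v.2
  have hzero : ∀ f ∈ 𝒜 0, ∃ c, f = algebraMap K A c := by
    intro f hf
    refine hinv f (Submodule.mem_iSup_of_mem 0 hf) fun j => ?_
    have := hτ j 0 f hf
    simpa [sub_eq_zero] using this
  have hle : ∀ n, 𝒜 n ≤ (weightLT K d (n + 1)).map (aeval y).toLinearMap := by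
    refine graded_le_map_weightLT hzero fun n hn => ?_
    obtain ⟨n, rfl⟩ : ∃ n', n = n' + 1 := ⟨n - 1, by omega⟩
    refine (hspan n).trans (sup_le_sup_right (Submodule.span_mono ?_) _)
    rintro _ ⟨t, rfl⟩
    exact ⟨⟨n, t⟩, rfl, rfl⟩
  have hθ : ∀ j v, ∃ θ ∈ weightLT K d (d v), aeval y θ = τ j (y v) - y v := by
    intro j v
    have h1 : ⨆ k < d v, 𝒜 k ≤ (weightLT K d (d v)).map (aeval y).toLinearMap :=
      iSup₂_le fun k hk => (hle k).trans (Submodule.map_mono (weightLT_mono hk))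
    exact h1 (hτ j (d v) _ (hy v))
  have hη : ∀ j v, ∃ η ∈ weightLT K d (d v), aeval y η = D j (y v) := fun j v =>
    hle v.1 (hD j v.1 _ (hy v))
  choose θ hθ hθy using hθ
  choose η hη hηy using hη
  refine ⟨(Σ n, T n), d, y, hd, hy, ?_, fun n f hf => ?_⟩
  · refine injective_aeval_of_invariant hroot hd τ D hθ hη hθy hηy (fun f hf v => ?_)
      fun f hf => hinv _ (aeval_mem_iSup_graded hone hmul hy f) hf
    have key : ∀ f : MvPolynomial _ K,
        ℓ v.1 v.2 (comp (v.1 + 1) (aeval y f)) = coeff (Finsupp.single v 1) f := by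
      intro f
      induction f using MvPolynomial.induction_on' with
      | add p q hp hq => rw [map_add, map_add, map_add, hp, hq, coeff_add]
      | monomial m c =>
        rw [coeff_monomial]
        have hm := aeval_monomial_mem_graded hone hmul hy m c
        by_cases hw : Finsupp.weight d m = v.1 + 1
        · rw [hw] at hm
          rw [hcomp_self _ _ hm]
          by_cases hX : ∃ u, m = Finsupp.single u 1
          · obtain ⟨⟨n, u⟩, rfl⟩ := hX
            obtain ⟨n', v⟩ := v
            obtain rfl : n = n' := by simpa [Finsupp.weight_apply, d] using hw
            rw [show monomial (Finsupp.single (⟨n, u⟩ : Σ n, T n) 1) c = C c * X ⟨n, u⟩ by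
              rw [C_mul_X_eq_monomial], map_mul, aeval_X, ← algebraMap_eq, AlgHom.commutes,
              ← Algebra.smul_def, map_smul, hℓY, smul_eq_mul]
            by_cases huv : v = u
            · simp [huv]
            · rw [if_neg huv, mul_zero, if_neg]
              intro h
              have := Finsupp.single_left_injective one_ne_zero h
              exact huv (by simpa using this.symm)
          · push Not at hX
            have h0 : m ≠ 0 := by
              rintro rfl
              simp at hw
            have h := aeval_monomial_mem_decomposables hone hmul hd hy h0 hX c
            rw [hw] at h
            rw [hℓD _ _ _ h, if_neg (hX v)]
        · rw [hcomp_ne _ _ hw _ hm, map_zero, if_neg]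
          rintro rfl
          exact hw (by simp [Finsupp.weight_apply, d])
    rw [← key]
    refine hℓD _ _ _ (hdec _ _ (hcomp_mem _ _) fun j => ?_)
    rw [← hcompD, hf j, map_zero]
  · obtain ⟨P, _, hP⟩ := hle n hf
    exact ⟨P, hP⟩

end GradedAlgebra

section Ultraproduct

variable {I : Type*} {U : Ultrafilter I}

/-- The ideal of families vanishing almost everywhere. -/
def vanishingIdeal (U : Ultrafilter I) (R : I → Type*) [∀ i, CommRing (R i)] :
    Ideal (∀ i, R i) where
  carrier := {f | ∀ᶠ i in U, f i = 0}
  zero_mem' := Filter.Eventually.of_forall fun _ => rfl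
  add_mem' hf hg := by
    filter_upwards [hf, hg] with i h1 h2
    rw [Pi.add_apply, h1, h2, add_zero]
  smul_mem' c f hf := by
    filter_upwards [hf] with i h
    rw [Pi.smul_apply', h, smul_zero]

/-- The ultraproduct of a family of commutative rings. -/
def UltraProd (U : Ultrafilter I) (R : I → Type*) [∀ i, CommRing (R i)] :=
  (∀ i, R i) ⧸ vanishingIdeal U R

namespace UltraProd

section Ring

variable {R : I → Type*} [∀ i, CommRing (R i)]

instance : CommRing (UltraProd U R) :=
  inferInstanceAs (CommRing ((∀ i, R i) ⧸ vanishingIdeal U R))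

/-- The class of a family. -/
def mk (U : Ultrafilter I) : (∀ i, R i) →+* UltraProd U R := Ideal.Quotient.mk _

theorem mk_surjective : Function.Surjective (mk U : (∀ i, R i) →+* UltraProd U R) :=
  Ideal.Quotient.mk_surjective

theorem mk_eq_zero {f : ∀ i, R i} : mk U f = 0 ↔ ∀ᶠ i in U, f i = 0 :=
  Ideal.Quotient.eq_zero_iff_mem

theorem mk_eq_mk {f g : ∀ i, R i} : mk U f = mk U g ↔ ∀ᶠ i in U, f i = g i := by
  rw [← sub_eq_zero, ← map_sub, mk_eq_zero]
  simp only [Pi.sub_apply, sub_eq_zero]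

instance [∀ i, Nontrivial (R i)] : Nontrivial (UltraProd U R) := by
  refine ⟨⟨0, 1, fun h => ?_⟩⟩
  rw [← map_one (mk U), eq_comm, mk_eq_zero] at h
  obtain ⟨i, hi⟩ := h.exists
  exact one_ne_zero hi

instance [∀ i, IsReduced (R i)] : IsReduced (UltraProd U R) := by
  refine ⟨fun x ⟨n, hx⟩ => ?_⟩
  obtain ⟨f, rfl⟩ := mk_surjective x
  rw [← map_pow, mk_eq_zero] at hx
  rw [mk_eq_zero]
  filter_upwards [hx] with i h
  exact eq_zero_of_pow_eq_zero h

end Ring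

noncomputable instance {K : I → Type*} [∀ i, Field (K i)] : Field (UltraProd U K) := by
  classical
  refine IsField.toField ⟨exists_pair_ne _, mul_comm, fun {x} hx => ?_⟩
  obtain ⟨f, rfl⟩ := mk_surjective x
  refine ⟨mk U fun i => (f i)⁻¹, ?_⟩
  rw [← map_mul, ← map_one (mk U), mk_eq_mk]
  rw [Ne, mk_eq_zero, ← Ultrafilter.eventually_not] at hx
  filter_upwards [hx] with i h
  exact mul_inv_cancel₀ h

section Algebra

variable {K : I → Type*} [∀ i, Field (K i)] {R : I → Type*} [∀ i, CommRing (R i)]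
  [∀ i, Algebra (K i) (R i)]

noncomputable instance : Algebra (UltraProd U K) (UltraProd U R) :=
  RingHom.toAlgebra (Ideal.quotientMap (I := vanishingIdeal U K) (vanishingIdeal U R)
    (RingHom.pi fun i => (algebraMap (K i) (R i)).comp (Pi.evalRingHom K i)) (by
      intro f hf
      change ∀ᶠ i in (U : Filter I), algebraMap (K i) (R i) (f i) = 0
      have hf' : ∀ᶠ i in (U : Filter I), f i = 0 := hf
      filter_upwards [hf'] with i h
      rw [h, map_zero]))

theorem algebraMap_mk (a : ∀ i, K i) : algebraMap (UltraProd U K) (UltraProd U R) (mk U a) =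
    mk U fun i => algebraMap (K i) (R i) (a i) := rfl

theorem mk_smul_mk (a : ∀ i, K i) (f : ∀ i, R i) :
    mk U a • mk U f = mk U fun i => a i • f i := by
  rw [Algebra.smul_def, algebraMap_mk, ← map_mul]
  congr 1
  ext i
  rw [Pi.mul_apply, Algebra.smul_def]

/-- The linear map of ultraproducts induced by a family of linear maps. -/
noncomputable def mapLinear (U : Ultrafilter I) (φ : ∀ i, R i →ₗ[K i] R i) :
    UltraProd U R →ₗ[UltraProd U K] UltraProd U R where
  toFun := Quotient.lift (fun f => mk U fun i => φ i (f i)) (by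
    intro f g h
    have h' : mk U f = mk U g := Quotient.sound h
    rw [mk_eq_mk] at *
    filter_upwards [h'] with i h
    rw [h])
  map_add' x y := by
    obtain ⟨f, rfl⟩ := mk_surjective x
    obtain ⟨g, rfl⟩ := mk_surjective y
    change mk U (fun i => φ i ((f + g) i)) = mk U (fun i => φ i (f i)) + mk U (fun i => φ i (g i))
    rw [← map_add]
    congr 1
    ext i
    simp
  map_smul' a x := by
    obtain ⟨a, rfl⟩ := mk_surjective a
    obtain ⟨f, rfl⟩ := mk_surjective x
    rw [mk_smul_mk]
    change mk U (fun i => φ i (a i • f i)) = mk U a • mk U (fun i => φ i (f i))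
    rw [mk_smul_mk]
    congr 1
    ext i
    simp

theorem mapLinear_mk (φ : ∀ i, R i →ₗ[K i] R i) (f : ∀ i, R i) :
    mapLinear U φ (mk U f) = mk U fun i => φ i (f i) := rfl

/-- The algebra endomorphism of an ultraproduct induced by a family of endomorphisms. -/
noncomputable def mapAlgHom (U : Ultrafilter I) (φ : ∀ i, R i →ₐ[K i] R i) :
    UltraProd U R →ₐ[UltraProd U K] UltraProd U R :=
  AlgHom.ofLinearMap (mapLinear U fun i => (φ i).toLinearMap)
    (by
      rw [← map_one (mk U), mapLinear_mk]
      congr 1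
      ext i
      simp)
    (by
      intro x y
      obtain ⟨f, rfl⟩ := mk_surjective x
      obtain ⟨g, rfl⟩ := mk_surjective y
      rw [← map_mul, mapLinear_mk, mapLinear_mk, mapLinear_mk, ← map_mul]
      congr 1
      ext i
      simp)

theorem mapAlgHom_mk (φ : ∀ i, R i →ₐ[K i] R i) (f : ∀ i, R i) :
    mapAlgHom U φ (mk U f) = mk U fun i => φ i (f i) := rfl

/-- The derivation of an ultraproduct induced by a family of derivations. -/
noncomputable def mapDerivation (U : Ultrafilter I) (φ : ∀ i, Derivation (K i) (R i) (R i)) :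
    Derivation (UltraProd U K) (UltraProd U R) (UltraProd U R) :=
  Derivation.mk' (mapLinear U fun i => (φ i).toLinearMap) (by
    intro x y
    obtain ⟨f, rfl⟩ := mk_surjective x
    obtain ⟨g, rfl⟩ := mk_surjective y
    rw [← map_mul, mapLinear_mk, mapLinear_mk, mapLinear_mk, smul_eq_mul, smul_eq_mul, ← map_mul,
      ← map_mul, ← map_add]
    congr 1
    ext i
    simp)

theorem mapDerivation_mk (φ : ∀ i, Derivation (K i) (R i) (R i)) (f : ∀ i, R i) :
    mapDerivation U φ (mk U f) = mk U fun i => φ i (f i) := rfl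

end Algebra

end UltraProd

end Ultraproduct

section PolynomialLemmas

open MvPolynomial

variable {σ K : Type*} [Field K]

theorem homogeneousComponent_pderiv (n : ℕ) (j : σ) (f : MvPolynomial σ K) :
    homogeneousComponent n (pderiv j f) = pderiv j (homogeneousComponent (n + 1) f) := by
  ext m
  rw [coeff_homogeneousComponent, coeff_pderiv, coeff_pderiv, coeff_homogeneousComponent]
  simp only [map_add, Finsupp.degree_single, add_left_inj]
  split_ifs <;> simp

theorem sum_smul_pderiv_apply [Fintype σ] (c : σ → K) (f : MvPolynomial σ K) :
    (∑ j, c j • pderiv j : Derivation K _ _) f = ∑ j, c j • pderiv j f := by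
  have h := congrFun (map_sum (Derivation.coeFnAddMonoidHom (R := K) (A := MvPolynomial σ K)
    (M := MvPolynomial σ K)) (fun j => c j • pderiv j) Finset.univ) f
  rw [Finset.sum_apply] at h
  exact h

theorem homogeneousComponent_sum_smul_pderiv [Fintype σ] (n : ℕ) (c : σ → K)
    (f : MvPolynomial σ K) : homogeneousComponent n ((∑ j, c j • pderiv j : Derivation K _ _) f) =
      (∑ j, c j • pderiv j : Derivation K _ _) (homogeneousComponent (n + 1) f) := by
  simp only [sum_smul_pderiv_apply, map_sum, map_smul, homogeneousComponent_pderiv]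

theorem homogeneousComponent_translate_sub {n k : ℕ} {f : MvPolynomial σ K}
    (hf : f.IsHomogeneous n) (hk : n ≤ k) (c : σ → K) :
    homogeneousComponent k (aeval (fun j => X j + C (c j)) f - f) = 0 := by
  have h1 : f ∈ weightLT K (fun _ : σ => 1) (n + 1) := by
    rw [mem_weightLT]
    intro m hm
    exact Nat.lt_succ_of_le (hf hm).le
  have h2 := aeval_X_add_sub_mem_weightLT (fun j => C_mem_weightLT (d := fun _ : σ => 1) (c j)) h1
  ext m
  rw [coeff_homogeneousComponent, coeff_zero]
  split_ifs with h
  · by_contra h3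
    have h4 := mem_weightLT.1 h2 m h3
    have h5 : m.degree = Finsupp.weight (fun _ : σ => 1) m := by
      rw [Finsupp.degree_eq_weight_one]
    omega
  · rfl

theorem eq_zero_or_eq_pow_of_pderiv_eq_zero {p : ℕ} [CharP K p] (hp : p.Prime)
    (hroot : ∀ a : K, ∃ b, b ^ p = a) {n : ℕ} {f : MvPolynomial σ K}
    (hf : f.IsHomogeneous (n + 1)) (h : ∀ j, pderiv j f = 0) :
    f = 0 ∨ ∃ q g, p * q = n + 1 ∧ g.IsHomogeneous q ∧ f = g ^ p := by
  have hZ : f ∈ dvdSupported K σ p := by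
    rw [mem_dvdSupported]
    intro m hm v
    by_contra hv
    have hmv : 1 ≤ m v := by
      by_contra h0
      simp [show m v = 0 by omega] at hv
    have h1 := coeff_pderiv (i := v) f (m - Finsupp.single v 1)
    rw [h, coeff_zero, tsub_add_cancel_of_le (Finsupp.single_le_iff.2 hmv), eq_comm, mul_eq_zero,
      or_iff_right hm, Finsupp.tsub_apply, Finsupp.single_eq_same, ← Nat.cast_add_one,
      Nat.sub_add_cancel hmv, CharP.cast_eq_zero_iff K p] at h1
    exact hv h1
  rcases eq_C_or_eq_pow_of_mem_dvdSupported (fun _ => hroot) hZ with ⟨c, rfl⟩ | ⟨_, g, rfl, hg⟩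
  · left
    by_contra h0
    have := hf.totalDegree h0
    simp at this
  · by_cases h0 : g = 0
    · exact Or.inl (by rw [h0, zero_pow hp.ne_zero])
    obtain ⟨m, hm⟩ := ne_zero_iff.1 h0
    have h1 := hf (hg m hm)
    refine Or.inr ⟨m.degree, g, ?_, fun m' hm' => ?_, rfl⟩
    · rw [map_nsmul, smul_eq_mul] at h1
      rw [Finsupp.degree_eq_weight_one]
      exact h1
    · have h2 := hf (hg m' hm')
      rw [map_nsmul, smul_eq_mul] at h1 h2
      rw [Finsupp.degree_eq_weight_one]
      exact Nat.eq_of_mul_eq_mul_left hp.pos (h2.trans h1.symm)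

theorem eq_C_of_translate_eq [Infinite K] {f : MvPolynomial σ K}
    (h : ∀ c : σ → K, aeval (fun j => X j + C (c j)) f = f) : ∃ a, f = C a := by
  refine ⟨eval 0 f, MvPolynomial.funext fun x => ?_⟩
  have h1 : ∀ g : MvPolynomial σ K, eval 0 (aeval (fun j => X j + C (x j)) g) = eval x g := by
    intro g
    induction g using MvPolynomial.induction_on with
    | C a => simp [← algebraMap_eq]
    | add p q hp hq => simp only [map_add, hp, hq]
    | mul_X p i hp =>
      rw [map_mul, map_mul, hp, aeval_X]
      simp
  rw [eval_C, ← h1, h x]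

end PolynomialLemmas

section UltraPoly

open MvPolynomial UltraProd

variable {I : Type w} {U : Ultrafilter I} {K : I → Type u} [∀ i, Field (K i)] {N : I → ℕ}

/-- The homogeneous component of degree `n` on an ultraproduct of polynomial rings. -/
noncomputable def ultraComp (U : Ultrafilter I) (K : I → Type u) [∀ i, Field (K i)] (N : I → ℕ)
    (n : ℕ) : UltraProd U (fun i => MvPolynomial (Fin (N i)) (K i)) →ₗ[UltraProd U K]
      UltraProd U fun i => MvPolynomial (Fin (N i)) (K i) :=
  mapLinear U fun _ => homogeneousComponent n

/-- The classes of the families of homogeneous polynomials of degree `n`. -/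
noncomputable def ultraGraded (U : Ultrafilter I) (K : I → Type u) [∀ i, Field (K i)] (N : I → ℕ)
    (n : ℕ) : Submodule (UltraProd U K) (UltraProd U fun i => MvPolynomial (Fin (N i)) (K i)) :=
  LinearMap.range (ultraComp U K N n)

theorem mem_ultraGraded {n : ℕ} {x : UltraProd U fun i => MvPolynomial (Fin (N i)) (K i)} :
    x ∈ ultraGraded U K N n ↔
      ∃ f : ∀ i, MvPolynomial (Fin (N i)) (K i), (∀ i, (f i).IsHomogeneous n) ∧ mk U f = x := by
  constructor
  · rintro ⟨y, rfl⟩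
    obtain ⟨f, rfl⟩ := mk_surjective y
    exact ⟨_, fun i => homogeneousComponent_isHomogeneous n (f i), rfl⟩
  · rintro ⟨f, hf, rfl⟩
    refine ⟨mk U f, ?_⟩
    rw [ultraComp, mapLinear_mk]
    congr 1
    ext1 i
    rw [homogeneousComponent_of_mem (hf i), if_pos rfl]

theorem mk_mem_ultraGraded {n : ℕ} {f : ∀ i, MvPolynomial (Fin (N i)) (K i)}
    (hf : ∀ᶠ i in U, (f i).IsHomogeneous n) : mk U f ∈ ultraGraded U K N n := by
  refine ⟨mk U f, ?_⟩
  rw [ultraComp, mapLinear_mk, mk_eq_mk]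
  filter_upwards [hf] with i h
  rw [homogeneousComponent_of_mem h, if_pos rfl]

theorem mk_mem_iSup_ultraGraded {D : ℕ} {f : ∀ i, MvPolynomial (Fin (N i)) (K i)}
    (hf : ∀ᶠ i in U, ∀ k, D ≤ k → homogeneousComponent k (f i) = 0) :
    mk U f ∈ ⨆ k < D, ultraGraded U K N k := by
  have h : mk U f = ∑ k ∈ Finset.range D, ultraComp U K N k (mk U f) := by
    simp only [ultraComp, mapLinear_mk]
    rw [← map_sum, mk_eq_mk]
    filter_upwards [hf] with i h
    rw [Finset.sum_apply]
    ext m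
    simp only [coeff_sum, coeff_homogeneousComponent]
    rw [Finset.sum_ite_eq]
    split_ifs with hm
    · rfl
    · have := congrArg (coeff m) (h m.degree (by simpa using hm))
      rwa [coeff_homogeneousComponent, if_pos rfl, coeff_zero] at this
  rw [h]
  refine sum_mem fun k hk => ?_
  exact Submodule.mem_iSup_of_mem k (Submodule.mem_iSup_of_mem (Finset.mem_range.1 hk) ⟨_, rfl⟩)

theorem exists_ultraGraded_algebraicIndependent [∀ i, IsAlgClosed (K i)] :
    ∃ (ι : Type (max u w)) (d : ι → ℕ)
      (y : ι → UltraProd U fun i => MvPolynomial (Fin (N i)) (K i)),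
      (∀ v, 0 < d v) ∧ (∀ v, y v ∈ ultraGraded U K N (d v)) ∧
      AlgebraicIndependent (UltraProd U K) y ∧
      ∀ n, ∀ f ∈ ultraGraded U K N n, ∃ P, aeval (R := UltraProd U K) y P = f := by
  obtain ⟨p, hp⟩ := CharP.exists (UltraProd U K)
  have hroot : p ≠ 0 → ∀ a : UltraProd U K, ∃ b, b ^ p = a := by
    intro hp0 a
    obtain ⟨a, rfl⟩ := mk_surjective a
    choose b hb using fun i => IsAlgClosed.exists_pow_nat_eq (a i) (Nat.pos_of_ne_zero hp0)
    refine ⟨mk U b, ?_⟩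
    rw [← map_pow]
    congr 1
    ext1 i
    exact hb i
  refine exists_algebraicIndependent_of_graded (𝒜 := ultraGraded U K N)
    (J := ∀ i, Fin (N i) → K i) hroot ?_ ?_
    (ultraComp U K N) (fun n f => ⟨f, rfl⟩) ?_ ?_
    (fun c => mapAlgHom U fun i => aeval fun j => X j + C (c i j)) ?_
    (fun c => mapDerivation U fun i => ∑ j, c i j • pderiv j) ?_ ?_ ?_ ?_
  · rw [← map_one (mk U)]
    exact mk_mem_ultraGraded (Filter.Eventually.of_forall fun i => isHomogeneous_one _ _)
  · intro k l a b ha hb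
    obtain ⟨f, hf, rfl⟩ := mem_ultraGraded.1 ha
    obtain ⟨g, hg, rfl⟩ := mem_ultraGraded.1 hb
    rw [← map_mul]
    exact mk_mem_ultraGraded (Filter.Eventually.of_forall fun i => (hf i).mul (hg i))
  · intro n f hf
    obtain ⟨f, hf', rfl⟩ := mem_ultraGraded.1 hf
    rw [ultraComp, mapLinear_mk]
    congr 1
    ext1 i
    rw [homogeneousComponent_of_mem (hf' i), if_pos rfl]
  · intro n m hnm f hf
    obtain ⟨f, hf', rfl⟩ := mem_ultraGraded.1 hf
    rw [ultraComp, mapLinear_mk, ← map_zero (mk U)]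
    congr 1
    ext1 i
    rw [homogeneousComponent_of_mem (hf' i), if_neg hnm.symm]
    rfl
  · intro c n f hf
    obtain ⟨f, hf', rfl⟩ := mem_ultraGraded.1 hf
    rw [mapAlgHom_mk, ← map_sub]
    exact mk_mem_iSup_ultraGraded (Filter.Eventually.of_forall fun i k hk =>
      homogeneousComponent_translate_sub (hf' i) hk (c i))
  · intro c n f hf
    obtain ⟨f, hf', rfl⟩ := mem_ultraGraded.1 hf
    rw [mapDerivation_mk]
    refine mk_mem_ultraGraded (Filter.Eventually.of_forall fun i => ?_)
    have h := homogeneousComponent_sum_smul_pderiv n (c i) (f i)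
    rw [homogeneousComponent_of_mem (hf' i), if_pos rfl] at h
    rw [← h]
    exact homogeneousComponent_isHomogeneous _ _
  · intro c n f
    obtain ⟨f, rfl⟩ := mk_surjective f
    rw [mapDerivation_mk, ultraComp, ultraComp, mapLinear_mk, mapLinear_mk, mapDerivation_mk]
    congr 1
    ext1 i
    exact homogeneousComponent_sum_smul_pderiv n (c i) (f i)
  · intro n f hf h
    obtain ⟨f, hf', rfl⟩ := mem_ultraGraded.1 hf
    have h1 : ∀ᶠ i in U, ∀ j, pderiv j (f i) = 0 := by
      classical
      by_contra h1
      rw [← Ultrafilter.eventually_not] at h1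
      push Not at h1
      have h2 : ∀ i, ∃ c : Fin (N i) → K i, (∃ j, pderiv j (f i) ≠ 0) →
          (∑ j, c j • pderiv j : Derivation (K i) _ _) (f i) ≠ 0 := by
        intro i
        by_cases h3 : ∃ j, pderiv j (f i) ≠ 0
        · obtain ⟨j, hj⟩ := h3
          refine ⟨Pi.single j 1, fun _ => ?_⟩
          rw [sum_smul_pderiv_apply, Finset.sum_eq_single j]
          · simpa using hj
          · intro j' _ hj'
            simp [Pi.single_eq_of_ne hj']
          · simp
        · exact ⟨0, fun h => absurd h h3⟩
      choose c hc using h2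
      have h3 := h c
      rw [mapDerivation_mk, mk_eq_zero] at h3
      obtain ⟨i, h4, h5⟩ := (h1.and h3).exists
      exact hc i h4 h5
    rcases CharP.char_is_prime_or_zero (UltraProd U K) p with hp' | rfl
    · have h2 : ∀ᶠ i in U, CharP (K i) p := by
        have h3 : mk U (fun i => (p : K i)) = 0 := by
          rw [show (fun i => (p : K i)) = ((p : ℕ) : ∀ i, K i) from rfl, map_natCast]
          exact CharP.cast_eq_zero _ p
        rw [mk_eq_zero] at h3
        filter_upwards [h3] with i h4
        exact (CharP.charP_iff_prime_eq_zero hp').2 h4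
      by_cases hf0 : ∀ᶠ i in U, f i = 0
      · rw [mk_eq_zero.2 hf0]
        exact zero_mem _
      rw [← Ultrafilter.eventually_not] at hf0
      have h3 : ∀ i, ∃ g, f i ≠ 0 → CharP (K i) p → (∀ j, pderiv j (f i) = 0) →
          ∃ q, p * q = n + 1 ∧ g.IsHomogeneous q ∧ f i = g ^ p := by
        intro i
        by_cases h4 : f i ≠ 0 ∧ CharP (K i) p ∧ ∀ j, pderiv j (f i) = 0
        · obtain ⟨h4, h5, h6⟩ := h4
          rcases eq_zero_or_eq_pow_of_pderiv_eq_zero hp'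
            (fun a => IsAlgClosed.exists_pow_nat_eq a hp'.pos) (hf' i) h6 with h7 | ⟨q, g, h7⟩
          · exact absurd h7 h4
          · exact ⟨g, fun _ _ _ => ⟨q, h7⟩⟩
        · exact ⟨0, fun h5 h6 h7 => absurd ⟨h5, h6, h7⟩ h4⟩
      choose g hg using h3
      have h4 : ∀ᶠ i in U, ∃ q, p * q = n + 1 ∧ (g i).IsHomogeneous q ∧ f i = g i ^ p := by
        filter_upwards [hf0, h1, h2] with i h5 h6 h7
        exact hg i h5 h7 h6
      obtain ⟨_, q, hq, _⟩ := h4.exists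
      have hq' : ∀ q', p * q' = n + 1 → q' = q := fun q' h =>
        Nat.eq_of_mul_eq_mul_left hp'.pos (h.trans hq.symm)
      have hq0 : 0 < q := Nat.pos_of_ne_zero fun h => by simp [h] at hq
      have h5 : mk U g ∈ ultraGraded U K N q := by
        refine mk_mem_ultraGraded ?_
        filter_upwards [h4] with i ⟨q', h5, h6, _⟩
        rwa [← hq' q' h5]
      have h6 : mk U (g ^ (p - 1)) ∈ ultraGraded U K N (q * (p - 1)) := by
        refine mk_mem_ultraGraded ?_
        filter_upwards [h4] with i ⟨q', h5, h6, _⟩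
        rw [← hq' q' h5]
        exact h6.pow _
      refine Submodule.subset_span ⟨q, q * (p - 1), _, _, hq0,
        Nat.mul_pos hq0 (Nat.sub_pos_of_lt hp'.one_lt), ?_, h5, h6, ?_⟩
      · obtain ⟨k, rfl⟩ := Nat.exists_eq_add_of_lt hp'.pos
        rw [← hq]
        simp
        ring
      · rw [← map_mul, mk_eq_mk]
        filter_upwards [h4] with i ⟨q', _, _, h7⟩
        rw [h7, Pi.mul_apply, Pi.pow_apply, ← pow_succ', Nat.sub_add_cancel hp'.pos]
    · have h2 : (n + 1 : UltraProd U K) • mk U f = 0 := by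
        have h3 : (n + 1 : UltraProd U K) = mk U fun i => (n + 1 : K i) := by
          rw [show (fun i => (n + 1 : K i)) = ((n : ∀ i, K i) + 1) from rfl, map_add, map_natCast,
            map_one]
        rw [h3, mk_smul_mk, mk_eq_zero]
        filter_upwards [h1] with i h4
        have h5 := (hf' i).sum_X_mul_pderiv
        simp only [h4, mul_zero, Finset.sum_const_zero] at h5
        rw [← Nat.cast_add_one, Nat.cast_smul_eq_nsmul, ← h5]
      have h3 : (n + 1 : UltraProd U K) ≠ 0 := by
        rw [← Nat.cast_add_one, Ne, CharP.cast_eq_zero_iff (UltraProd U K) 0]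
        simp
      rw [(smul_eq_zero_iff_right h3).1 h2]
      exact zero_mem _
  · intro f _ h
    obtain ⟨f, rfl⟩ := mk_surjective f
    have h1 : ∀ᶠ i in U, ∀ c : Fin (N i) → K i, aeval (fun j => X j + C (c j)) (f i) = f i := by
      by_contra h1
      rw [← Ultrafilter.eventually_not] at h1
      push Not at h1
      have h2 : ∀ i, ∃ c : Fin (N i) → K i, (∃ c' : Fin (N i) → K i,
        aeval (fun j => X j + C (c' j)) (f i) ≠ f i) →
        aeval (fun j => X j + C (c j)) (f i) ≠ f i := by
        intro i
        by_cases h3 : ∃ c' : Fin (N i) → K i, aeval (fun j => X j + C (c' j)) (f i) ≠ f i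
        · exact ⟨h3.choose, fun _ => h3.choose_spec⟩
        · exact ⟨0, fun h => absurd h h3⟩
      choose c hc using h2
      have h3 := h c
      rw [mapAlgHom_mk, mk_eq_mk] at h3
      obtain ⟨i, h4, h5⟩ := (h1.and h3).exists
      exact hc i h4 h5
    have h2 : ∀ i, ∃ a, (∀ c : Fin (N i) → K i, aeval (fun j => X j + C (c j)) (f i) = f i) →
        f i = C a := by
      intro i
      by_cases h3 : ∀ c : Fin (N i) → K i, aeval (fun j => X j + C (c j)) (f i) = f i
      · obtain ⟨a, ha⟩ := eq_C_of_translate_eq h3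
        exact ⟨a, fun _ => ha⟩
      · exact ⟨0, fun h => absurd h h3⟩
    choose a ha using h2
    refine ⟨mk U a, ?_⟩
    rw [algebraMap_mk, mk_eq_mk]
    filter_upwards [h1] with i h3
    exact ha i h3

end UltraPoly

section HomogeneousCofactors

open MvPolynomial

theorem Ideal.mem_span_image_lt {R : Type*} [CommRing R] {s : ℕ} (y : Fin s → R) (k : ℕ) (x : R) :
    x ∈ Ideal.span (y '' {j : Fin s | (j : ℕ) < k}) ↔
      ∃ c : Fin s → R, ∑ j ∈ Finset.univ.filter (fun j : Fin s => (j : ℕ) < k), c j * y j = x := by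
  have h : {j : Fin s | (j : ℕ) < k} = ↑(Finset.univ.filter fun j : Fin s => (j : ℕ) < k) := by
    ext j
    simp
  rw [h, Ideal.span, Submodule.mem_span_image_finset_iff_exists_fun']
  rfl

variable {σ K : Type*} [CommRing K]

theorem homogeneousComponent_mul_of_isHomogeneous {d : ℕ} {y : MvPolynomial σ K}
    (hy : y.IsHomogeneous d) (c : MvPolynomial σ K) (n : ℕ) :
    homogeneousComponent n (c * y) = if d ≤ n then homogeneousComponent (n - d) c * y else 0 := by
  conv_lhs => rw [← sum_homogeneousComponent c, Finset.sum_mul, map_sum]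
  have h : ∀ k, homogeneousComponent n (homogeneousComponent k c * y) =
      if n = k + d then homogeneousComponent k c * y else 0 := fun k =>
    homogeneousComponent_of_mem ((homogeneousComponent_isHomogeneous k c).mul hy)
  simp only [h]
  split_ifs with hd
  · rw [Finset.sum_congr rfl fun k _ => if_congr (show n = k + d ↔ n - d = k by omega) rfl rfl,
      Finset.sum_ite_eq]
    split_ifs with hm
    · rfl
    · rw [homogeneousComponent_eq_zero, zero_mul]
      rw [Finset.mem_range] at hm
      omega
  · refine Finset.sum_eq_zero fun k _ => if_neg ?_
    omega

theorem MvPolynomial.IsHomogeneous.exists_homogeneous_cofactors {ι : Type*} {s : Finset ι}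
    {d : ι → ℕ}
    {y : ι → MvPolynomial σ K} (hy : ∀ j ∈ s, (y j).IsHomogeneous (d j)) {n : ℕ}
    {x : MvPolynomial σ K} (hx : x.IsHomogeneous n) {c : ι → MvPolynomial σ K}
    (h : ∑ j ∈ s, c j * y j = x) :
    ∃ c' : ι → MvPolynomial σ K, (∀ j, (c' j).IsHomogeneous (n - d j)) ∧
      (∀ j, n < d j → c' j = 0) ∧ ∑ j ∈ s, c' j * y j = x := by
  refine ⟨fun j => if d j ≤ n then homogeneousComponent (n - d j) (c j) else 0, fun j => ?_,
    fun j hj => if_neg (by omega), ?_⟩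
  · dsimp only
    split_ifs
    · exact homogeneousComponent_isHomogeneous _ _
    · exact isHomogeneous_zero _ _ _
  · have h1 : homogeneousComponent n x = x := by rw [homogeneousComponent_of_mem hx, if_pos rfl]
    rw [← h1, ← h, map_sum]
    refine Finset.sum_congr rfl fun j hj => ?_
    rw [homogeneousComponent_mul_of_isHomogeneous (hy j hj)]
    dsimp only
    split_ifs
    · rfl
    · rw [zero_mul]

theorem MvPolynomial.mem_span_X_of_X_mul_mem {K : Type*} [Field K] {ι : Type*} {s : Set ι} {v : ι}
    (hv : v ∉ s) {P : MvPolynomial ι K}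
    (h : X v * P ∈ Ideal.span (X '' s : Set (MvPolynomial ι K))) :
    P ∈ Ideal.span (X '' s : Set (MvPolynomial ι K)) := by
  classical
  rw [mem_ideal_span_X_image] at h ⊢
  intro m hm
  obtain ⟨j, hj, h1⟩ := h (Finsupp.single v 1 + m) (by
    rw [mem_support_iff, coeff_X_mul]
    exact mem_support_iff.1 hm)
  refine ⟨j, hj, ?_⟩
  have hjv : j ≠ v := fun h => hv (by rwa [← h])
  rwa [Finsupp.add_apply, Finsupp.single_eq_of_ne hjv, zero_add] at h1

end HomogeneousCofactors

section UltraParameters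

open MvPolynomial UltraProd

variable {I : Type w} {U : Ultrafilter I} {K : I → Type u} [∀ i, Field (K i)] {N : I → ℕ}

theorem exists_aeval_mk_eq {s : ℕ} (y : Fin s → ∀ i, MvPolynomial (Fin (N i)) (K i))
    (Q : MvPolynomial (Fin s) (UltraProd U K)) :
    ∃ q : ∀ i, MvPolynomial (Fin s) (K i), (∀ i, (q i).totalDegree ≤ Q.totalDegree) ∧
      aeval (fun k => mk U (y k)) Q = mk U fun i => aeval (fun k => y k i) (q i) := by
  choose c hc using fun m => mk_surjective (coeff m Q)
  refine ⟨fun i => ∑ m ∈ Q.support, monomial m (c m i), fun i => ?_, ?_⟩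
  · refine totalDegree_finsetSum_le fun m hm => ?_
    refine (totalDegree_monomial_le _ _).trans ?_
    exact le_totalDegree hm
  · rw [aeval_def, eval₂_eq']
    simp only [← hc, algebraMap_mk, ← map_pow, ← map_prod, ← map_mul, ← map_sum]
    congr 1
    ext1 i
    rw [map_sum, Finset.sum_apply]
    refine Finset.sum_congr rfl fun m _ => ?_
    rw [aeval_monomial, Pi.mul_apply, Finset.prod_apply, Finsupp.prod_fintype _ _ (by simp)]
    rfl

theorem exists_regular_parameters [∀ i, IsAlgClosed (K i)] {r D : ℕ}
    (f : ∀ i, Fin r → MvPolynomial (Fin (N i)) (K i)) (hf : ∀ i j, (f i j).totalDegree ≤ D) :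
    ∃ (s : ℕ) (d : Fin s → ℕ) (E : ℕ) (y : ∀ i, Fin s → MvPolynomial (Fin (N i)) (K i)),
      (∀ k, 0 < d k) ∧ (∀ i k, (y i k).IsHomogeneous (d k)) ∧
      (∀ᶠ i in U, ∀ j, ∃ P : MvPolynomial (Fin s) (K i), P.totalDegree ≤ E ∧
        aeval (y i) P = f i j) ∧
      ∀ (k : Fin s) (n : ℕ) (g : ∀ i, MvPolynomial (Fin (N i)) (K i)),
        (∀ᶠ i in U, (g i).IsHomogeneous n) →
        (∀ᶠ i in U, y i k * g i ∈ Ideal.span (y i '' {j : Fin s | (j : ℕ) < k})) →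
        ∀ᶠ i in U, g i ∈ Ideal.span (y i '' {j : Fin s | (j : ℕ) < k}) := by
  classical
  obtain ⟨ι, d, y, hd, hy, hindep, hsurj⟩ :=
    exists_ultraGraded_algebraicIndependent (U := U) (K := K) (N := N)
  have hle : ⨆ k < D + 1, ultraGraded U K N k ≤
      LinearMap.range (aeval (R := UltraProd U K) y).toLinearMap :=
    iSup₂_le fun n _ x hx => hsurj n x hx
  have hP : ∀ j, ∃ P, aeval (R := UltraProd U K) y P = mk U fun i => f i j := fun j =>
    hle (mk_mem_iSup_ultraGraded (Filter.Eventually.of_forall fun i k hk =>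
      homogeneousComponent_eq_zero _ _ ((hf i j).trans_lt hk)))
  choose P hP using hP
  let W : Finset ι := Finset.univ.biUnion fun j => (P j).vars
  let e : Fin W.card ≃ W := W.equivFin.symm
  have he : Function.Injective fun k => (e k : ι) := Subtype.val_injective.comp e.injective
  have hQ : ∀ j, ∃ Q : MvPolynomial (Fin W.card) (UltraProd U K),
      rename (fun k => (e k : ι)) Q = P j := by
    intro j
    refine exists_rename_eq_of_vars_subset_range _ _ he fun v hv => ?_
    have hv' : v ∈ W := Finset.mem_biUnion.2 ⟨j, Finset.mem_univ _, hv⟩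
    exact ⟨e.symm ⟨v, hv'⟩, by simp⟩
  choose Q hQ using hQ
  choose z hz hzy using fun k => mem_ultraGraded.1 (hy (e k : ι))
  have hQf : ∀ j, aeval (fun k => mk U (z k)) (Q j) = mk U fun i => f i j := by
    intro j
    rw [← hP, ← hQ, aeval_rename]
    congr 2
    ext1 k
    exact hzy k
  choose q hq hqf using fun j => exists_aeval_mk_eq z (Q j)
  refine ⟨W.card, fun k => d (e k), Finset.univ.sup fun j => (Q j).totalDegree, fun i k => z k i,
    fun k => hd _, fun i k => hz k i, ?_, ?_⟩
  · have h1 : ∀ j, ∀ᶠ i in U, aeval (fun k => z k i) (q j i) = f i j := fun j =>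
      mk_eq_mk.1 ((hqf j).symm.trans (hQf j))
    filter_upwards [Filter.eventually_all.2 h1] with i hi j
    exact ⟨q j i, (hq j i).trans (Finset.le_sup (f := fun j => (Q j).totalDegree)
      (Finset.mem_univ j)), hi j⟩
  · intro k n g hg hgk
    have h1 : ∀ i, ∃ c : Fin W.card → MvPolynomial (Fin (N i)) (K i),
        (g i).IsHomogeneous n →
        z k i * g i ∈ Ideal.span ((fun k => z k i) '' {j : Fin W.card | (j : ℕ) < k}) →
        (∀ j, (c j).IsHomogeneous (d (e k) + n - d (e j))) ∧
          ∑ j ∈ Finset.univ.filter (fun j : Fin W.card => (j : ℕ) < k),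
            c j * z j i = z k i * g i := by
      intro i
      by_cases h2 : (g i).IsHomogeneous n ∧
        z k i * g i ∈ Ideal.span ((fun k => z k i) '' {j : Fin W.card | (j : ℕ) < k})
      · obtain ⟨c, hc⟩ := (Ideal.mem_span_image_lt _ _ _).1 h2.2
        obtain ⟨c', h3, _, h4⟩ := MvPolynomial.IsHomogeneous.exists_homogeneous_cofactors
          (fun j _ => hz j i) ((hz k i).mul h2.1) hc
        exact ⟨c', fun _ _ => ⟨h3, h4⟩⟩
      · exact ⟨0, fun h3 h4 => absurd ⟨h3, h4⟩ h2⟩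
    choose c hc using h1
    obtain ⟨G, hG⟩ := hsurj n _ (mk_mem_ultraGraded hg)
    have h2 : ∀ j, ∃ C, aeval (R := UltraProd U K) y C = mk U fun i => c i j := by
      intro j
      refine hsurj (d (e k) + n - d (e j)) _ (mk_mem_ultraGraded ?_)
      filter_upwards [hg, hgk] with i h3 h4
      exact (hc i h3 h4).1 j
    choose C hC using h2
    have h3 : ∑ j ∈ Finset.univ.filter (fun j : Fin W.card => (j : ℕ) < k),
        C j * X (e j : ι) = X (e k : ι) * G := by
      apply hindep
      rw [map_sum, map_mul, aeval_X, hG, ← hzy, ← map_mul]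
      simp only [map_mul, aeval_X, hC, ← hzy]
      simp only [← map_mul, ← map_sum]
      rw [mk_eq_mk]
      filter_upwards [hg, hgk] with i h4 h5
      rw [Finset.sum_apply]
      exact (hc i h4 h5).2
    have himage : (fun j : Fin W.card => (X (e j : ι) : MvPolynomial ι (UltraProd U K))) ''
        {j : Fin W.card | (j : ℕ) < k} =
          X '' ((fun j => (e j : ι)) '' {j : Fin W.card | (j : ℕ) < k}) := by
      rw [Set.image_image]
    have h4 : G ∈ Ideal.span (X '' ((fun j => (e j : ι)) '' {j : Fin W.card | (j : ℕ) < k}) :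
        Set (MvPolynomial ι (UltraProd U K))) := by
      refine mem_span_X_of_X_mul_mem (v := (e k : ι)) ?_ ?_
      · rintro ⟨j, hj, h5⟩
        rw [he h5] at hj
        exact lt_irrefl (k : ℕ) hj
      · rw [← himage, Ideal.mem_span_image_lt]
        exact ⟨C, h3⟩
    rw [← himage, Ideal.mem_span_image_lt] at h4
    obtain ⟨B, hB⟩ := h4
    choose b hb using fun j => mk_surjective (aeval (R := UltraProd U K) y (B j))
    have h5 : (mk U fun i => ∑ j ∈ Finset.univ.filter (fun j : Fin W.card => (j : ℕ) < k),
        b j i * z j i) = mk U g := by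
      rw [← hG, ← hB, map_sum]
      simp only [map_mul, aeval_X, ← hb, ← hzy]
      simp only [← map_mul, ← map_sum]
      congr 1
      ext1 i
      rw [Finset.sum_apply]
      rfl
    filter_upwards [mk_eq_mk.1 h5] with i h6
    rw [Ideal.mem_span_image_lt]
    exact ⟨fun j => b j i, h6⟩

end UltraParameters

section FlatTransfer

open MvPolynomial

theorem eval₂Hom_eq_comp_optionEquivLeft {K : Type*} [CommRing K] {τ τ' R : Type*} [CommRing R]
    (f : K →+* R) (ε : τ' ≃ Option τ) (u : τ' → R) :
    eval₂Hom f u = (Polynomial.eval₂RingHom (eval₂Hom f fun t => u (ε.symm (some t)))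
      (u (ε.symm none))).comp
        (((renameEquiv K ε).trans (optionEquivLeft K τ)).toRingEquiv : _ →+* _) := by
  refine ringHom_ext (fun a => ?_) fun t => ?_
  · simp
  · obtain ⟨t, rfl⟩ := ε.symm.surjective t
    cases t <;> simp

theorem flat_eval₂Hom_iff_of_equiv {K : Type*} [CommRing K] {τ τ' R : Type*} [CommRing R]
    (f : K →+* R) (ε : τ' ≃ Option τ) (u : τ' → R) :
    (eval₂Hom f u).Flat ↔ (Polynomial.eval₂RingHom (eval₂Hom f fun t => u (ε.symm (some t)))
      (u (ε.symm none))).Flat := by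
  set E := ((renameEquiv K ε).trans (optionEquivLeft K τ)).toRingEquiv
  have h := eval₂Hom_eq_comp_optionEquivLeft f ε u
  constructor
  · intro h1
    have h2 : Polynomial.eval₂RingHom (eval₂Hom f fun t => u (ε.symm (some t)))
        (u (ε.symm none)) = (eval₂Hom f u).comp (E.symm : _ →+* _) := by
      rw [h, RingHom.comp_assoc]
      have h3 : (E : MvPolynomial τ' K →+* Polynomial (MvPolynomial τ K)).comp
          (E.symm : Polynomial (MvPolynomial τ K) →+* MvPolynomial τ' K) = RingHom.id _ :=
        RingHom.ext fun x => E.apply_symm_apply x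
      rw [h3, RingHom.comp_id]
    rw [h2]
    exact (RingHom.Flat.of_bijective E.symm.bijective).comp h1
  · intro h1
    rw [h]
    exact (RingHom.Flat.of_bijective E.bijective).comp h1

/-- Exchanging a variable in a flat evaluation map against an element over which it is integral. -/
theorem flat_eval₂Hom_exchange {K : Type u} [CommRing K] {τ τ₁ τ₂ : Type} {R : Type u}
    [CommRing R] (f : K →+* R) (ε₁ : τ₁ ≃ Option τ) (ε₂ : τ₂ ≃ Option τ) (u₁ : τ₁ → R)
    (u₂ : τ₂ → R) (hu : ∀ t, u₁ (ε₁.symm (some t)) = u₂ (ε₂.symm (some t)))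
    (h : (eval₂Hom f u₁).Flat) (hint : (eval₂Hom f u₂).IsIntegralElem (u₁ (ε₁.symm none))) :
    (eval₂Hom f u₂).Flat := by
  rw [flat_eval₂Hom_iff_of_equiv f ε₂]
  rw [flat_eval₂Hom_iff_of_equiv f ε₁, funext hu] at h
  obtain ⟨P, hP, hP0⟩ := hint
  rw [eval₂Hom_eq_comp_optionEquivLeft f ε₂, ← Polynomial.eval₂_map] at hP0
  exact RingHom.Flat.eval₂RingHom_exchange _ _ _ h _ (hP.map _) hP0

theorem flat_eval₂Hom_inl {K : Type*} [CommRing K] {κ τ R : Type*} [CommRing R]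
    (f : K →+* R) (y : κ → R) (z : τ → R) (h : (eval₂Hom f (Sum.elim y z)).Flat) :
    (eval₂Hom f y).Flat := by
  have h1 : eval₂Hom f y = (eval₂Hom f (Sum.elim y z)).comp
      ((((sumRingEquiv K τ κ).symm.trans
        (renameEquiv K (Equiv.sumComm τ κ)).toRingEquiv) : _ →+* _).comp
        (C : MvPolynomial κ K →+* MvPolynomial τ (MvPolynomial κ K))) := by
    refine ringHom_ext (fun a => ?_) fun t => ?_
    · simp
    · simp
  rw [h1]
  refine RingHom.Flat.comp (RingHom.Flat.comp ?_ (RingHom.Flat.of_bijective ?_)) h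
  · exact RingHom.flat_algebraMap_iff.2
      (inferInstance : Module.Flat (MvPolynomial κ K) (MvPolynomial τ (MvPolynomial κ K)))
  · exact RingEquiv.bijective _

end FlatTransfer

section RelativeParameters

open MvPolynomial

variable {σ κ ρ : Type} {K : Type u} [Field K] {l : ℕ}

theorem homogeneousComponent_aeval_of_linear {τ : Type*} {z : τ → MvPolynomial σ K}
    (hz : ∀ j, (z j).IsHomogeneous 1) (c : MvPolynomial τ K) (n : ℕ) :
    homogeneousComponent n (aeval z c) = aeval z (homogeneousComponent n c) := by
  conv_lhs => rw [← sum_homogeneousComponent c, map_sum, map_sum]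
  have h : ∀ k, homogeneousComponent n (aeval z (homogeneousComponent k c)) =
      if n = k then aeval z (homogeneousComponent k c) else 0 := fun k =>
    homogeneousComponent_of_mem (by
      have := (homogeneousComponent_isHomogeneous k c).aeval z hz
      rwa [one_mul] at this)
  simp only [h]
  rw [Finset.sum_ite_eq]
  split_ifs with hn
  · rfl
  · rw [homogeneousComponent_eq_zero, map_zero]
    rw [Finset.mem_range] at hn
    omega

theorem homogeneousComponent_mem_span_range [Finite κ] {d : κ → ℕ} {y : κ → MvPolynomial σ K}
    (hy : ∀ j, (y j).IsHomogeneous (d j)) {x : MvPolynomial σ K}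
    (hx : x ∈ Ideal.span (Set.range y)) (n : ℕ) :
    homogeneousComponent n x ∈ Ideal.span (Set.range y) := by
  have := Fintype.ofFinite κ
  obtain ⟨c, rfl⟩ := (Ideal.mem_span_range_iff_exists_fun).1 hx
  rw [map_sum]
  refine sum_mem fun j _ => ?_
  rw [homogeneousComponent_mul_of_isHomogeneous (hy j)]
  split_ifs
  · exact Ideal.mul_mem_left _ _ (Ideal.subset_span ⟨j, rfl⟩)
  · exact zero_mem _

variable [Fintype ρ]

/-- A graded form of Nakayama's lemma. -/
theorem finite_eval₂Hom_of_generate [Finite κ] {d : κ → ℕ} {y : κ → MvPolynomial σ K}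
    (hy : ∀ j, (y j).IsHomogeneous (d j)) (hd : ∀ j, 0 < d j) {z : Fin l → MvPolynomial σ K}
    (hz : ∀ j, (z j).IsHomogeneous 1) {e : ρ → MvPolynomial σ K}
    (he : ∀ a, ∃ δ, (e a).IsHomogeneous δ)
    (hgen : ∀ x, ∃ c : ρ → MvPolynomial (Fin l) K,
      x - ∑ a, aeval z (c a) * e a ∈ Ideal.span (Set.range y)) :
    (eval₂Hom C (Sum.elim y z) : _ →+* MvPolynomial σ K).Finite := by
  have := Fintype.ofFinite κ
  classical
  choose δ hδ using he
  let _ : Algebra (MvPolynomial (κ ⊕ Fin l) K) (MvPolynomial σ K) :=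
    (eval₂Hom C (Sum.elim y z)).toAlgebra
  have hsmul : ∀ (b : MvPolynomial (κ ⊕ Fin l) K) (x : MvPolynomial σ K),
      b • x = eval₂Hom C (Sum.elim y z) b * x := fun _ _ => rfl
  let M : Submodule (MvPolynomial (κ ⊕ Fin l) K) (MvPolynomial σ K) :=
    Submodule.span _ (Set.range e)
  have hzM : ∀ (c : MvPolynomial (Fin l) K) a, aeval z c * e a ∈ M := by
    intro c a
    have h1 : aeval z c = eval₂Hom C (Sum.elim y z) (rename Sum.inr c) := by
      rw [coe_eval₂Hom, eval₂_rename, aeval_def, algebraMap_eq]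
      rfl
    rw [h1, ← hsmul]
    exact M.smul_mem _ (Submodule.subset_span ⟨a, rfl⟩)
  have hyM : ∀ x ∈ M, ∀ j, x * y j ∈ M := by
    intro x hx j
    have h1 : x * y j = (X (Sum.inl j) : MvPolynomial (κ ⊕ Fin l) K) • x := by
      rw [hsmul]
      simp [mul_comm]
    rw [h1]
    exact M.smul_mem _ hx
  have hM : ∀ n, ∀ x : MvPolynomial σ K, x.IsHomogeneous n → x ∈ M := by
    intro n
    induction n using Nat.strong_induction_on with
    | _ n ih =>
      intro x hx
      obtain ⟨c, hc⟩ := hgen x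
      obtain ⟨b, hb⟩ := (Ideal.mem_span_range_iff_exists_fun).1 hc
      have h1 : x = ∑ a, homogeneousComponent n (aeval z (c a) * e a) +
          ∑ j, homogeneousComponent n (b j * y j) := by
        rw [← map_sum, ← map_sum, ← map_add, hb, add_sub_cancel, homogeneousComponent_of_mem hx,
          if_pos rfl]
      rw [h1]
      refine add_mem (sum_mem fun a _ => ?_) (sum_mem fun j _ => ?_)
      · rw [homogeneousComponent_mul_of_isHomogeneous (hδ a)]
        split_ifs
        · rw [homogeneousComponent_aeval_of_linear hz]
          exact hzM _ _
        · exact zero_mem _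
      · rw [homogeneousComponent_mul_of_isHomogeneous (hy j)]
        split_ifs with h
        · exact hyM _ (ih _ (Nat.sub_lt ((hd j).trans_le h) (hd j)) _
            (homogeneousComponent_isHomogeneous _ _)) j
        · exact zero_mem _
  refine ⟨⟨Finset.univ.image e, ?_⟩⟩
  rw [eq_top_iff]
  intro x _
  rw [← sum_homogeneousComponent x, Finset.coe_image, Finset.coe_univ, Set.image_univ]
  exact sum_mem fun n _ => hM n _ (homogeneousComponent_isHomogeneous _ _)

/-- Linear forms `z` such that, over the polynomial ring in `y` and `z`, the ambient polynomial ring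
is flat and, modulo `y`, generated by the homogeneous polynomials `e`. -/
structure IsRelativeParameters (y : κ → MvPolynomial σ K) (z : Fin l → MvPolynomial σ K)
    (e : ρ → MvPolynomial σ K) : Prop where
  linear : ∀ j, (z j).IsHomogeneous 1
  homogeneous : ∀ a, ∃ δ, (e a).IsHomogeneous δ
  generate : ∀ x, ∃ c : ρ → MvPolynomial (Fin l) K,
    x - ∑ a, aeval z (c a) * e a ∈ Ideal.span (Set.range y)
  flat : (eval₂Hom C (Sum.elim y z) : _ →+* MvPolynomial σ K).Flat

theorem aeval_shear {z : Fin (l + 1) → MvPolynomial σ K} (a : Fin l → K)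
    (p : MvPolynomial (Fin (l + 1)) K) :
    aeval (fun j => aeval z (shear (-a) (X j))) (shear a p) = aeval z p := by
  have h : (aeval fun j => aeval z (shear (-a) (X j))) = (aeval z).comp (shear (-a)) :=
    algHom_ext fun j => by simp
  rw [h, AlgHom.comp_apply, shear_neg_shear]

theorem IsRelativeParameters.shear {y : κ → MvPolynomial σ K}
    {z : Fin (l + 1) → MvPolynomial σ K} {e : ρ → MvPolynomial σ K}
    (h : IsRelativeParameters y z e) (a : Fin l → K) :
    IsRelativeParameters y (fun j => aeval z (shear (-a) (X j))) e where
  linear j := by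
    have := ((isHomogeneous_X K j).shear (-a)).aeval z h.linear
    rwa [one_mul] at this
  homogeneous := h.homogeneous
  generate x := by
    obtain ⟨c, hc⟩ := h.generate x
    refine ⟨fun b => _root_.shear a (c b), ?_⟩
    simpa only [aeval_shear] using hc
  flat := by
    let ψ : (Fin l → K) → MvPolynomial (κ ⊕ Fin (l + 1)) K →ₐ[K] MvPolynomial (κ ⊕ Fin (l + 1)) K :=
      fun b => aeval (Sum.elim (fun t => X (Sum.inl t)) fun j =>
        rename Sum.inr (_root_.shear b (X j)))
    have hψr : ∀ b p, ψ b (rename Sum.inr p) = rename Sum.inr (_root_.shear b p) := by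
      intro b p
      suffices (ψ b).comp (rename Sum.inr) = (rename Sum.inr).comp (_root_.shear b) from
        DFunLike.congr_fun this p
      refine algHom_ext fun j => ?_
      simp [ψ]
    have hψψ : ∀ b p, ψ (-b) (ψ b p) = p := by
      intro b p
      suffices (ψ (-b)).comp (ψ b) = AlgHom.id K _ from DFunLike.congr_fun this p
      refine algHom_ext fun j => ?_
      rcases j with t | j
      · simp [ψ]
      · have h1 : ψ b (X (Sum.inr j)) = rename Sum.inr (_root_.shear b (X j)) := by simp [ψ]
        rw [AlgHom.comp_apply, h1, hψr, shear_neg_shear, rename_X, AlgHom.id_apply]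
    have hbij : Function.Bijective (ψ (-a)) := by
      refine Function.bijective_iff_has_inverse.2 ⟨ψ a, fun p => ?_, hψψ a⟩
      simpa using hψψ (-a) p
    have heq : (eval₂Hom C (Sum.elim y fun j => aeval z (_root_.shear (-a) (X j))) :
        _ →+* MvPolynomial σ K) = (eval₂Hom C (Sum.elim y z)).comp (ψ (-a) : _ →+* _) := by
      refine ringHom_ext (fun c => ?_) fun j => ?_
      · simp
      · rcases j with t | j
        · simp [ψ]
        · simp only [eval₂Hom_X', Sum.elim_inr, RingHom.comp_apply, RingHom.coe_coe, ψ, aeval_X]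
          rw [coe_eval₂Hom, eval₂_rename, aeval_def, algebraMap_eq]
          rfl
    rw [heq]
    exact (RingHom.Flat.of_bijective hbij).comp h.flat

end RelativeParameters

section CayleyHamilton

open MvPolynomial
open scoped Matrix

theorem Matrix.det_eq_zero_of_mulVec_eq_zero_of_sum_eq_one {Q ρ : Type*} [CommRing Q] [Fintype ρ]
    [DecidableEq ρ] {A : Matrix ρ ρ Q} {e v : ρ → Q} (h : A *ᵥ e = 0) (hv : ∑ a, v a * e a = 1) :
    A.det = 0 := by
  have h1 : A.det • e = 0 := by
    rw [← one_mulVec e, ← smul_mulVec, ← adjugate_mul, ← mulVec_mulVec, h, mulVec_zero]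
  rw [← mul_one A.det, ← hv, Finset.mul_sum]
  refine Finset.sum_eq_zero fun a _ => ?_
  have := congrFun h1 a
  rw [Pi.smul_apply, smul_eq_mul, Pi.zero_apply] at this
  rw [mul_left_comm, this, mul_zero]

variable {σ κ ρ : Type} {K : Type u} [Field K] {l : ℕ} [Fintype ρ]

/-- A homogeneous polynomial satisfies, modulo `y`, a homogeneous integral equation over the
polynomial ring in `z`, of degree the number of generators. -/
theorem exists_homogeneous_integral_equation [Finite κ] {d : κ → ℕ} {y : κ → MvPolynomial σ K}
    (hy : ∀ j, (y j).IsHomogeneous (d j)) {z : Fin l → MvPolynomial σ K}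
    (hz : ∀ j, (z j).IsHomogeneous 1) {e : ρ → MvPolynomial σ K}
    (hgen : ∀ x, ∃ c : ρ → MvPolynomial (Fin l) K,
      x - ∑ a, aeval z (c a) * e a ∈ Ideal.span (Set.range y))
    {w : MvPolynomial σ K} {δ : ℕ} (hw : w.IsHomogeneous δ) :
    ∃ c : ℕ → MvPolynomial (Fin l) K,
      (∀ j ≤ Fintype.card ρ, (c j).IsHomogeneous ((Fintype.card ρ - j) * δ)) ∧
      c (Fintype.card ρ) = 1 ∧
      ∑ j ∈ Finset.range (Fintype.card ρ + 1), aeval z (c j) * w ^ j ∈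
        Ideal.span (Set.range y) := by
  classical
  set g := Fintype.card ρ
  choose M hM using fun a => hgen (w * e a)
  obtain ⟨v, hv⟩ := hgen 1
  let π := Ideal.Quotient.mk (Ideal.span (Set.range y))
  let φ : MvPolynomial (Fin l) K →+* MvPolynomial σ K ⧸ Ideal.span (Set.range y) :=
    π.comp (aeval z : _ →ₐ[K] MvPolynomial σ K).toRingHom
  have hφ : ∀ c, φ c = π (aeval z c) := fun _ => rfl
  let A : Matrix ρ ρ (MvPolynomial (Fin l) K) := Matrix.of M
  have h1 : (Matrix.scalar ρ (π w) - A.map φ).det = 0 := by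
    refine Matrix.det_eq_zero_of_mulVec_eq_zero_of_sum_eq_one (e := fun a => π (e a))
      (v := fun a => φ (v a)) ?_ ?_
    · ext a
      rw [Matrix.sub_mulVec, Pi.sub_apply, Pi.zero_apply, Matrix.scalar_apply,
        Matrix.mulVec_diagonal, Matrix.mulVec, dotProduct]
      simp only [Matrix.map_apply, hφ, A, Matrix.of_apply, ← map_mul, ← map_sum, ← map_sub]
      exact Ideal.Quotient.eq_zero_iff_mem.2 (hM a)
    · simp only [hφ, ← map_mul, ← map_sum]
      rw [← map_one π, eq_comm, Ideal.Quotient.eq]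
      exact hv
  rw [← Matrix.eval_charpoly, Matrix.charpoly_map, Polynomial.eval_map,
    Polynomial.eval₂_eq_sum_range, Matrix.charpoly_natDegree_eq_dim] at h1
  simp only [hφ, ← map_pow, ← map_mul, ← map_sum] at h1
  have h2 := homogeneousComponent_mem_span_range hy (Ideal.Quotient.eq_zero_iff_mem.1 h1) (g * δ)
  refine ⟨fun j => homogeneousComponent ((g - j) * δ) (A.charpoly.coeff j), fun j _ =>
    homogeneousComponent_isHomogeneous _ _, ?_, ?_⟩
  · have h3 : A.charpoly.coeff g = 1 := by
      have := A.charpoly_monic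
      rwa [Polynomial.Monic, Polynomial.leadingCoeff, Matrix.charpoly_natDegree_eq_dim] at this
    dsimp only
    rw [h3, Nat.sub_self, zero_mul, homogeneousComponent_of_mem (isHomogeneous_one _ _), if_pos rfl]
  · rw [map_sum] at h2
    convert h2 using 1
    refine Finset.sum_congr rfl fun j hj => ?_
    have hjg : j ≤ g := Nat.lt_succ_iff.1 (Finset.mem_range.1 hj)
    rw [homogeneousComponent_mul_of_isHomogeneous (hw.pow j), mul_comm δ j,
      if_pos (Nat.mul_le_mul_right δ hjg), ← Nat.sub_mul,
      homogeneousComponent_aeval_of_linear hz]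

end CayleyHamilton

section Exchange

open MvPolynomial

variable {σ κ κ' ρ : Type} {K : Type u} [Field K] {l : ℕ} [Fintype ρ]

theorem IsRelativeParameters.exchange [Finite κ'] {d : κ' → ℕ} {y : κ' → MvPolynomial σ K}
    (ε : κ' ≃ Option κ) (hy : ∀ j, (y j).IsHomogeneous (d j)) (hd : ∀ j, 0 < d j)
    {z : Fin (l + 1) → MvPolynomial σ K} {e : ρ → MvPolynomial σ K}
    (h : IsRelativeParameters (fun j => y (ε.symm (some j))) z e)
    {c : MvPolynomial (Fin (l + 1)) K} {t : ℕ} {u : K} (hu : u ≠ 0)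
    (hc : (finSuccEquiv K l c).coeff t = C u) (hct : (finSuccEquiv K l c).natDegree ≤ t)
    (hcy : aeval z c ∈ Ideal.span (Set.range y)) :
    IsRelativeParameters y (fun j => z j.succ)
      fun p : ρ × Fin t => e p.1 * z 0 ^ (p.2 : ℕ) := by
  have hspan : Ideal.span (Set.range fun j => y (ε.symm (some j))) ≤ Ideal.span (Set.range y) :=
    Ideal.span_mono (by rintro _ ⟨j, rfl⟩; exact ⟨_, rfl⟩)
  have hlin : ∀ j : Fin l, (z j.succ).IsHomogeneous 1 := fun j => h.linear _
  have hhom : ∀ p : ρ × Fin t, ∃ δ, (e p.1 * z 0 ^ (p.2 : ℕ)).IsHomogeneous δ := by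
    intro p
    obtain ⟨δ, hδ⟩ := h.homogeneous p.1
    exact ⟨_, hδ.mul ((h.linear 0).pow _)⟩
  have hgen : ∀ x, ∃ b : ρ × Fin t → MvPolynomial (Fin l) K,
      x - ∑ p, aeval (fun j : Fin l => z j.succ) (b p) * (e p.1 * z 0 ^ (p.2 : ℕ)) ∈
        Ideal.span (Set.range y) := by
    intro x
    let Ψ : Polynomial (MvPolynomial (Fin l) K) →+* MvPolynomial σ K :=
      (aeval z).toRingHom.comp ((finSuccEquiv K l).symm : _ →+* MvPolynomial (Fin (l + 1)) K)
    have hΨ : ∀ p, Ψ (finSuccEquiv K l p) = aeval z p := by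
      intro p
      simp [Ψ]
    have hΨC : ∀ r, Ψ (Polynomial.C r) = aeval (fun j : Fin l => z j.succ) r := by
      intro r
      simp only [Ψ, RingHom.comp_apply, RingHom.coe_coe, finSuccEquiv_symm_C,
        AlgHom.toRingHom_eq_coe, aeval_rename]
      rfl
    have hΨX : Ψ Polynomial.X = z 0 := by
      simp only [Ψ, RingHom.comp_apply, RingHom.coe_coe, finSuccEquiv_symm_X,
        AlgHom.toRingHom_eq_coe, aeval_X]
    let P := finSuccEquiv K l c * Polynomial.C (C u⁻¹)
    have hP : P.Monic := by
      refine Polynomial.monic_of_natDegree_le_of_coeff_eq_one t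
        ((Polynomial.natDegree_mul_C_le _ _).trans hct) ?_
      rw [Polynomial.coeff_mul_C, hc, ← C_mul, mul_inv_cancel₀ hu, C_1]
    have hPt : P.natDegree ≤ t := (Polynomial.natDegree_mul_C_le _ _).trans hct
    have hΨP : Ψ P ∈ Ideal.span (Set.range y) := by
      rw [map_mul, hΨ]
      exact Ideal.mul_mem_right _ _ hcy
    obtain ⟨b, hb⟩ := h.generate x
    let r := fun a => finSuccEquiv K l (b a) %ₘ P
    have hr : ∀ a, Ψ (r a) = ∑ i : Fin t,
        aeval (fun j : Fin l => z j.succ) ((r a).coeff i) * z 0 ^ (i : ℕ) := by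
      intro a
      have h1 : (r a).degree < t := by
        refine (Polynomial.degree_modByMonic_lt _ hP).trans_le ?_
        exact Polynomial.degree_le_natDegree.trans (by exact_mod_cast hPt)
      have h2 := Polynomial.sum_fin (fun i x => Polynomial.C x * Polynomial.X ^ i) (by simp) h1
      rw [Polynomial.sum_C_mul_X_pow_eq] at h2
      rw [← h2, map_sum]
      refine Finset.sum_congr rfl fun i _ => ?_
      rw [h2, map_mul, map_pow, hΨC, hΨX]
    have hb' : ∀ a, aeval z (b a) = Ψ (r a) + Ψ P * Ψ (finSuccEquiv K l (b a) /ₘ P) := by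
      intro a
      rw [← map_mul, ← map_add, Polynomial.modByMonic_add_div, hΨ]
    refine ⟨fun p => (r p.1).coeff p.2, ?_⟩
    have h3 : ∑ p : ρ × Fin t, aeval (fun j : Fin l => z j.succ) ((r p.1).coeff p.2) *
        (e p.1 * z 0 ^ (p.2 : ℕ)) = ∑ a, Ψ (r a) * e a := by
      rw [Fintype.sum_prod_type]
      refine Finset.sum_congr rfl fun a _ => ?_
      rw [hr, Finset.sum_mul]
      refine Finset.sum_congr rfl fun i _ => ?_
      ring
    have h4 : x - ∑ a, Ψ (r a) * e a = (x - ∑ a, aeval z (b a) * e a) +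
        ∑ a, Ψ P * (Ψ (finSuccEquiv K l (b a) /ₘ P) * e a) := by
      simp only [hb', add_mul, Finset.sum_add_distrib, mul_assoc]
      ring
    rw [h3, h4]
    exact add_mem (hspan hb) (sum_mem fun a _ => Ideal.mul_mem_right _ _ hΨP)
  refine ⟨hlin, hhom, hgen, ?_⟩
  let α : Option (κ ⊕ Fin l) ≃ κ ⊕ Fin (l + 1) := Equiv.ofBijective
    (fun | none => Sum.inr 0 | some (Sum.inl t) => Sum.inl t | some (Sum.inr j) => Sum.inr j.succ)
    ⟨by
      rintro (_ | _ | i) (_ | _ | j) hij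
      all_goals simp_all [Fin.succ_ne_zero, (Fin.succ_ne_zero _).symm], by
      rintro (t | j)
      · exact ⟨some (Sum.inl t), rfl⟩
      · refine Fin.cases ⟨none, rfl⟩ (fun j => ⟨some (Sum.inr j), rfl⟩) j⟩
  let β : Option (κ ⊕ Fin l) ≃ κ' ⊕ Fin l := Equiv.ofBijective
    (fun | none => Sum.inl (ε.symm none) | some (Sum.inl t) => Sum.inl (ε.symm (some t))
         | some (Sum.inr j) => Sum.inr j)
    ⟨by
      rintro (_ | _ | i) (_ | _ | j) hij
      all_goals simp_all, by
      rintro (t | j)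
      · obtain ⟨t, rfl⟩ := ε.symm.surjective t
        cases t with
        | none => exact ⟨none, rfl⟩
        | some t => exact ⟨some (Sum.inl t), rfl⟩
      · exact ⟨some (Sum.inr j), rfl⟩⟩
  refine flat_eval₂Hom_exchange C α.symm β.symm _ _ ?_ h.flat ?_
  · rintro (t | j) <;> rfl
  · exact (finite_eval₂Hom_of_generate hy hd hlin hhom hgen).to_isIntegral _

end Exchange

section RelativeParametersExchange

open MvPolynomial

variable {σ κ ρ : Type} {K : Type u} [Field K] {l : ℕ} [Fintype ρ]

theorem constantCoeff_eq_zero_of_mem_span_range {κ : Type*} {d : κ → ℕ} {y : κ → MvPolynomial σ K}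
    (hy : ∀ j, (y j).IsHomogeneous (d j)) (hd : ∀ j, 0 < d j) {x : MvPolynomial σ K}
    (hx : x ∈ Ideal.span (Set.range y)) : constantCoeff x = 0 := by
  have h : Ideal.span (Set.range y) ≤ RingHom.ker (constantCoeff : MvPolynomial σ K →+* K) := by
    rw [Ideal.span_le]
    rintro _ ⟨j, rfl⟩
    exact (hy j).coeff_eq_zero (d := 0) (by simpa using (hd j).ne)
  exact h hx

theorem IsRelativeParameters.exists_exchange [Infinite K] {κ' : Type} [Finite κ'] {d : κ' → ℕ}
    {y : κ' → MvPolynomial σ K} (ε : κ' ≃ Option κ) (hy : ∀ j, (y j).IsHomogeneous (d j))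
    (hd : ∀ j, 0 < d j) {z : Fin l → MvPolynomial σ K} {e : ρ → MvPolynomial σ K}
    (h : IsRelativeParameters (fun j => y (ε.symm (some j))) z e) {c : MvPolynomial (Fin l) K}
    (hc0 : c ≠ 0) {t T : ℕ} (hc : c.IsHomogeneous t) (htT : t ≤ T)
    (hcy : aeval z c ∈ Ideal.span (Set.range y)) :
    ∃ (l' : ℕ) (z' : Fin l' → MvPolynomial σ K) (e' : ρ × Fin T → MvPolynomial σ K),
      IsRelativeParameters y z' e' := by
  cases l with
  | zero =>
    obtain ⟨u, rfl⟩ := C_surjective (Fin 0) c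
    rw [aeval_C] at hcy
    have := constantCoeff_eq_zero_of_mem_span_range hy hd hcy
    simp only [algebraMap_eq, constantCoeff_C] at this
    exact absurd (by rw [this, C_0]) hc0
  | succ l =>
    have hX : (X 0 : MvPolynomial (Fin (l + 1)) K) ^ (T - t) ≠ 0 := pow_ne_zero _ (X_ne_zero 0)
    have hb0 : c * X 0 ^ (T - t) ≠ 0 := mul_ne_zero hc0 hX
    have hb : (c * X 0 ^ (T - t)).IsHomogeneous T := by
      have := hc.mul ((isHomogeneous_X K (0 : Fin (l + 1))).pow (T - t))
      rwa [one_mul, Nat.add_sub_cancel' htT] at this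
    obtain ⟨a, u, hu, hau⟩ := exists_shear_coeff_eq_C hb0
    rw [hb.totalDegree hb0] at hau
    refine ⟨l, _, _, (h.shear a).exchange ε hy hd hu hau
      ((natDegree_finSuccEquiv_le_totalDegree _).trans (hb.shear a).totalDegree_le) ?_⟩
    rw [aeval_shear, map_mul]
    exact Ideal.mul_mem_right _ _ hcy

theorem exists_ne_zero_aeval_mem [Finite κ] {d : κ → ℕ} {y : κ → MvPolynomial σ K}
    (hy : ∀ j, (y j).IsHomogeneous (d j)) {z : Fin l → MvPolynomial σ K}
    {e : ρ → MvPolynomial σ K} (h : IsRelativeParameters y z e) {w : MvPolynomial σ K} {δ : ℕ}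
    (hw : w.IsHomogeneous δ)
    (hreg : ∀ m ≤ Fintype.card ρ, ∀ G : MvPolynomial σ K,
      G.IsHomogeneous ((Fintype.card ρ - m) * δ) →
      w ^ m * G ∈ Ideal.span (Set.range y) → G ∈ Ideal.span (Set.range y)) :
    ∃ (t : ℕ) (c : MvPolynomial (Fin l) K), t ≤ Fintype.card ρ * δ ∧ c ≠ 0 ∧ c.IsHomogeneous t ∧
      ∃ b, aeval z c - w * b ∈ Ideal.span (Set.range y) := by
  classical
  obtain ⟨c, hc, hc1, hsum⟩ := exists_homogeneous_integral_equation hy h.linear h.generate hw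
  set g := Fintype.card ρ
  have hex : ∃ j, c j ≠ 0 := ⟨g, by rw [hc1]; exact one_ne_zero⟩
  set m := Nat.find hex with hm
  have hmg : m ≤ g := Nat.find_min' hex (by rw [hc1]; exact one_ne_zero)
  have hlt : ∀ j < m, c j = 0 := fun j hj => not_not.1 (Nat.find_min hex hj)
  refine ⟨(g - m) * δ, c m, Nat.mul_le_mul_right _ (Nat.sub_le _ _), Nat.find_spec hex,
    hc m hmg, ?_⟩
  have hG := hreg m hmg (∑ j ∈ Finset.range (g - m + 1), aeval z (c (m + j)) * w ^ j) ?_ ?_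
  · rw [Finset.sum_range_succ'] at hG
    refine ⟨-∑ j ∈ Finset.range (g - m), aeval z (c (m + (j + 1))) * w ^ j, ?_⟩
    convert hG using 1
    rw [mul_neg, sub_neg_eq_add, Finset.mul_sum, add_comm, add_zero, pow_zero, mul_one]
    congr 1
    exact Finset.sum_congr rfl fun j _ => by ring
  · refine IsHomogeneous.sum _ _ _ fun j hj => ?_
    have hj' : j ≤ g - m := Nat.lt_succ_iff.1 (Finset.mem_range.1 hj)
    have h1 := ((hc (m + j) (by omega)).aeval z h.linear).mul (hw.pow j)
    convert h1 using 1
    rw [one_mul, mul_comm δ, ← add_mul]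
    congr 1
    omega
  · convert hsum using 1
    have : g + 1 = m + (g - m + 1) := by omega
    have h0 : ∑ j ∈ Finset.range m, aeval z (c j) * w ^ j = 0 :=
      Finset.sum_eq_zero fun j hj => by rw [hlt j (Finset.mem_range.1 hj), map_zero, zero_mul]
    rw [this, Finset.sum_range_add _ m, h0, zero_add, Finset.mul_sum]
    exact Finset.sum_congr rfl fun j _ => by ring

end RelativeParametersExchange

section FlatParameters

open MvPolynomial Filter

variable {I : Type w} {U : Filter I} {K : I → Type u} [∀ i, Field (K i)] {N : I → ℕ}

theorem eventually_forall_mem_of_pow_mul_mem {y : ∀ i, MvPolynomial (Fin (N i)) (K i)} {d : ℕ}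
    (hy : ∀ i, (y i).IsHomogeneous d) {J : ∀ i, Ideal (MvPolynomial (Fin (N i)) (K i))}
    (hreg : ∀ (n : ℕ) (g : ∀ i, MvPolynomial (Fin (N i)) (K i)),
      (∀ᶠ i in U, (g i).IsHomogeneous n) → (∀ᶠ i in U, y i * g i ∈ J i) → ∀ᶠ i in U, g i ∈ J i)
    (m n : ℕ) : ∀ᶠ i in U, ∀ g : MvPolynomial (Fin (N i)) (K i),
      g.IsHomogeneous n → y i ^ m * g ∈ J i → g ∈ J i := by
  have h1 : ∀ n, ∀ᶠ i in U, ∀ g : MvPolynomial (Fin (N i)) (K i),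
      g.IsHomogeneous n → y i * g ∈ J i → g ∈ J i := by
    intro n
    have : ∀ i, ∃ g : MvPolynomial (Fin (N i)) (K i), g.IsHomogeneous n ∧ y i * g ∈ J i ∧
        (g ∈ J i → ∀ g : MvPolynomial (Fin (N i)) (K i),
          g.IsHomogeneous n → y i * g ∈ J i → g ∈ J i) := by
      intro i
      by_cases h : ∀ g : MvPolynomial (Fin (N i)) (K i),
          g.IsHomogeneous n → y i * g ∈ J i → g ∈ J i
      · exact ⟨0, isHomogeneous_zero _ _ _, by simp, fun _ => h⟩
      · push Not at h
        obtain ⟨g, hg, hyg, hgJ⟩ := h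
        exact ⟨g, hg, hyg, fun h => absurd h hgJ⟩
    choose g hg hyg hgJ using this
    filter_upwards [hreg n g (.of_forall hg) (.of_forall hyg)] with i hi using hgJ i hi
  induction m with
  | zero => exact .of_forall fun i g _ hg => by simpa using hg
  | succ m ih =>
    filter_upwards [ih, h1 (d * m + n)] with i hi hi1 g hg hyg
    refine hi g hg (hi1 _ (((hy i).pow m).mul hg) ?_)
    rwa [← mul_assoc, ← pow_succ']

theorem isRelativeParameters_X {κ : Type} [IsEmpty κ] {K : Type u} [Field K] {l : ℕ}
    (y : κ → MvPolynomial (Fin l) K) :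
    IsRelativeParameters y X fun _ : Unit => (1 : MvPolynomial (Fin l) K) where
  linear := isHomogeneous_X K
  homogeneous _ := ⟨0, isHomogeneous_one _ _⟩
  generate x := ⟨fun _ => x, by simp⟩
  flat := by
    refine RingHom.Flat.of_bijective ?_
    have : (eval₂Hom C (Sum.elim y X) : MvPolynomial (κ ⊕ Fin l) K →+* MvPolynomial (Fin l) K) =
        (renameEquiv K (Equiv.emptySum κ (Fin l)) : _ →+* _) := by
      refine MvPolynomial.ringHom_ext (by simp) ?_
      rintro (j | j)
      · exact isEmptyElim j
      · simp
    rw [this]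
    exact (renameEquiv K (Equiv.emptySum κ (Fin l))).bijective

theorem range_comp_castLE {α : Type*} {s k : ℕ} (h : k ≤ s) (y : Fin s → α) :
    Set.range (fun j : Fin k => y (Fin.castLE h j)) = y '' {j : Fin s | (j : ℕ) < k} := by
  ext x
  constructor
  · rintro ⟨j, rfl⟩
    exact ⟨_, j.2, rfl⟩
  · rintro ⟨j, hj, rfl⟩
    exact ⟨⟨j, hj⟩, rfl⟩

theorem exists_eventually_isRelativeParameters [∀ i, Infinite (K i)] {s : ℕ} {d : Fin s → ℕ}
    {y : ∀ i, Fin s → MvPolynomial (Fin (N i)) (K i)} (hd : ∀ k, 0 < d k)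
    (hy : ∀ i k, (y i k).IsHomogeneous (d k))
    (hreg : ∀ (k : Fin s) (n : ℕ) (g : ∀ i, MvPolynomial (Fin (N i)) (K i)),
      (∀ᶠ i in U, (g i).IsHomogeneous n) →
      (∀ᶠ i in U, y i k * g i ∈ Ideal.span (y i '' {j : Fin s | (j : ℕ) < k})) →
      ∀ᶠ i in U, g i ∈ Ideal.span (y i '' {j : Fin s | (j : ℕ) < k})) (k : ℕ) (hk : k ≤ s) :
    ∃ (ρ : Type) (_ : Fintype ρ), ∀ᶠ i in U, ∃ (l : ℕ) (z : Fin l → MvPolynomial (Fin (N i)) (K i))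
      (e : ρ → MvPolynomial (Fin (N i)) (K i)),
      IsRelativeParameters (fun j : Fin k => y i (Fin.castLE hk j)) z e := by
  induction k with
  | zero => exact ⟨Unit, inferInstance, .of_forall fun i => ⟨_, _, _, isRelativeParameters_X _⟩⟩
  | succ k ih =>
    obtain ⟨ρ, _, hρ⟩ := ih (k.le_succ.trans hk)
    have h1 : ∀ᶠ i in U, ∀ m ∈ Finset.range (Fintype.card ρ + 1),
        ∀ G : MvPolynomial (Fin (N i)) (K i),
        G.IsHomogeneous ((Fintype.card ρ - m) * d ⟨k, hk⟩) →
        y i ⟨k, hk⟩ ^ m * G ∈ Ideal.span (y i '' {j : Fin s | (j : ℕ) < k}) →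
        G ∈ Ideal.span (y i '' {j : Fin s | (j : ℕ) < k}) :=
      (eventually_all_finset _).2 fun m _ => eventually_forall_mem_of_pow_mul_mem
        (y := fun i => y i ⟨k, hk⟩) (fun i => hy i _) (hreg ⟨k, hk⟩) m _
    refine ⟨ρ × Fin (Fintype.card ρ * d ⟨k, hk⟩), inferInstance, ?_⟩
    filter_upwards [hρ, h1] with i ⟨l, z, e, h⟩ hi
    rw [← range_comp_castLE (k.le_succ.trans hk)] at hi
    obtain ⟨t, c, ht, hc0, hc, b, hb⟩ := exists_ne_zero_aeval_mem (fun j => hy i _) h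
      (hy i ⟨k, hk⟩) fun m hm => hi m (Finset.mem_range.2 (Nat.lt_succ_of_le hm))
    refine IsRelativeParameters.exists_exchange finSuccEquivLast (fun j => hy i _) (fun j => hd _)
      (z := z) (e := e) ?_ hc0 hc ht ?_
    · simp only [finSuccEquivLast_symm_some]
      exact h
    · have h2 : Ideal.span (Set.range fun j : Fin k => y i (Fin.castLE (k.le_succ.trans hk) j)) ≤
          Ideal.span (Set.range fun j : Fin (k + 1) => y i (Fin.castLE hk j)) :=
        Ideal.span_mono (by rintro _ ⟨j, rfl⟩; exact ⟨j.castSucc, rfl⟩)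
      rw [← sub_add_cancel (aeval z c) (y i ⟨k, hk⟩ * b)]
      exact add_mem (h2 hb) (Ideal.mul_mem_right _ _ (Ideal.subset_span ⟨Fin.last k, rfl⟩))

theorem eventually_flat_eval₂Hom [∀ i, Infinite (K i)] {s : ℕ} {d : Fin s → ℕ}
    {y : ∀ i, Fin s → MvPolynomial (Fin (N i)) (K i)} (hd : ∀ k, 0 < d k)
    (hy : ∀ i k, (y i k).IsHomogeneous (d k))
    (hreg : ∀ (k : Fin s) (n : ℕ) (g : ∀ i, MvPolynomial (Fin (N i)) (K i)),
      (∀ᶠ i in U, (g i).IsHomogeneous n) →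
      (∀ᶠ i in U, y i k * g i ∈ Ideal.span (y i '' {j : Fin s | (j : ℕ) < k})) →
      ∀ᶠ i in U, g i ∈ Ideal.span (y i '' {j : Fin s | (j : ℕ) < k})) :
    ∀ᶠ i in U, (eval₂Hom C (y i) : _ →+* MvPolynomial (Fin (N i)) (K i)).Flat := by
  obtain ⟨ρ, _, h⟩ := exists_eventually_isRelativeParameters hd hy hreg s le_rfl
  filter_upwards [h] with i ⟨l, z, e, h⟩
  exact flat_eval₂Hom_inl C _ z h.flat

end FlatParameters

section RowBound

open MvPolynomial Filter

/-- Relations among polynomials in `y` come from relations in the small polynomial ring, when the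
big one is flat over it. -/
theorem KerBounded.of_flat {σ : Type*} {K : Type*} [Field K] {r t : ℕ} {τ : Type*}
    {y : τ → MvPolynomial σ K} (hflat : (eval₂Hom C y : _ →+* MvPolynomial σ K).Flat)
    {e : ℕ} (hy : ∀ k, (y k).totalDegree ≤ e) {v : Fin r → MvPolynomial τ K}
    (h : KerBounded (fun (_ : Unit) j => v j) t) :
    KerBounded (fun (_ : Unit) j => aeval y (v j)) (t + t * e) := by
  have hφ : ∀ p, (eval₂Hom C y : _ →+* MvPolynomial σ K) p = aeval y p := fun _ => rfl
  obtain ⟨h, h1, h2, h3⟩ := h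
  refine KerBounded.of_fintype (fun a j => aeval y (h a j)) (by simp) (fun a j => ?_)
    (fun a => ?_) fun x hx => ?_
  · exact (totalDegree_aeval_le y hy _).trans
      ((Nat.mul_le_mul_right _ (h1 a j)).trans (Nat.le_add_left _ _))
  · ext1 i
    have := congrArg (aeval y) (congrFun (h2 a) i)
    simpa only [Matrix.mulVec, dotProduct, map_sum, map_mul, Pi.zero_apply, map_zero] using this
  · have hx' : ∑ i, aeval y (v i) * x i = 0 := congrFun hx ()
    obtain ⟨k, a, b, hab, ha⟩ := (RingHom.flat_iff_exists_of_sum_mul_eq_zero _).1 hflat hx'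
    choose c hc using fun j => h3 (fun i => a i j) (by ext1 u; exact ha j)
    refine ⟨fun p => ∑ j, aeval y (c j p) * b j, ?_⟩
    ext1 i
    have h4 : ∀ j, a i j = ∑ p, c j p * h p i := fun j => by
      simpa only [Finset.sum_apply, Pi.smul_apply, smul_eq_mul] using congrFun (hc j) i
    rw [hab i, Finset.sum_apply]
    simp only [Pi.smul_apply, smul_eq_mul, hφ, h4, map_sum, map_mul, Finset.sum_mul]
    rw [Finset.sum_comm]
    exact Finset.sum_congr rfl fun p _ => Finset.sum_congr rfl fun j _ => by ring

theorem exists_kerBounded_row_of_isAlgClosed (r D : ℕ) : ∃ t : ℕ, ∀ (K : Type u) [Field K]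
    [IsAlgClosed K] (N : ℕ) (v : Fin r → MvPolynomial (Fin N) K), (∀ j, (v j).totalDegree ≤ D) →
      KerBounded (fun (_ : Unit) j => v j) t := by
  by_contra! hcon
  choose K hK hK' N f hf hbad using hcon
  obtain ⟨s, d, E, y, hd, hy, hP, hreg⟩ := exists_regular_parameters (U := hyperfilter ℕ) f hf
  have : ∀ i, Infinite (K i) := fun i => IsAlgClosed.instInfinite
  have hflat := eventually_flat_eval₂Hom hd hy hreg
  obtain ⟨β, hβ⟩ := exists_kerBounded_row.{u} s
  let e := ∑ k, d k
  have hev : ∀ᶠ i in hyperfilter ℕ, β r E + β r E * e ≤ i :=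
    Nat.hyperfilter_le_atTop (eventually_ge_atTop _)
  obtain ⟨i, hPi, hi, hle⟩ := (hP.and (hflat.and hev)).exists
  choose P hPE hPf using hPi
  refine hbad i (KerBounded.mono ?_ hle)
  have := KerBounded.of_flat hi (e := e) (fun k => (hy i k).totalDegree_le.trans
    (Finset.single_le_sum (f := d) (fun _ _ => Nat.zero_le _) (Finset.mem_univ k)))
    (hβ (K i) r E P hPE)
  simpa only [hPf] using this

end RowBound

section Kernel

open MvPolynomial
open scoped Matrix

theorem exists_span_eq_ker_mkQ_comp {σ K : Type*} [Field K] {m r n t : ℕ}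
    (A : Matrix (Fin m) (Fin r) (MvPolynomial σ K)) (g : Fin n → Fin m → MvPolynomial σ K)
    (h : KerBounded (Matrix.of fun i => Fin.append (A i) fun a => g a i) t) :
    ∃ h : Fin t → (Fin r → MvPolynomial σ K), (∀ a l, (h a l).totalDegree ≤ t) ∧
      Submodule.span (MvPolynomial σ K) (Set.range h) =
        LinearMap.ker ((Submodule.span (MvPolynomial σ K) (Set.range g)).mkQ ∘ₗ A.mulVecLin) := by
  have hmul : ∀ (x : Fin r → MvPolynomial σ K) (c : Fin n → MvPolynomial σ K),
      (Matrix.of fun i => Fin.append (A i) fun a => g a i) *ᵥ Fin.append x c =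
        A *ᵥ x + ∑ a, c a • g a := by
    intro x c
    ext1 i
    simp [Matrix.mulVec, dotProduct, Fin.sum_univ_add, mul_comm]
  have hker : ∀ x, x ∈ LinearMap.ker
      ((Submodule.span (MvPolynomial σ K) (Set.range g)).mkQ ∘ₗ A.mulVecLin) ↔
      ∃ c : Fin n → MvPolynomial σ K, ∑ a, c a • g a = A *ᵥ x := by
    intro x
    rw [LinearMap.mem_ker, LinearMap.comp_apply, Submodule.mkQ_apply,
      Submodule.Quotient.mk_eq_zero, Matrix.mulVecLin_apply,
      Submodule.mem_span_range_iff_exists_fun]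
  obtain ⟨h, h1, h2, h3⟩ := h
  refine ⟨fun a j => h a (Fin.castAdd n j), fun a j => h1 a _, le_antisymm ?_ fun x hx => ?_⟩
  · rw [Submodule.span_le]
    rintro _ ⟨a, rfl⟩
    refine (hker _).2 ⟨fun b => -h a (Fin.natAdd r b), ?_⟩
    have h4 := hmul (fun j => h a (Fin.castAdd n j)) fun b => h a (Fin.natAdd r b)
    rw [Fin.append_castAdd_natAdd, h2] at h4
    simp only [neg_smul, Finset.sum_neg_distrib]
    exact neg_eq_of_add_eq_zero_left h4.symm
  · obtain ⟨c, hc⟩ := (hker x).1 hx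
    obtain ⟨b, hb⟩ := h3 (Fin.append x (-c)) (by
      rw [hmul, ← hc]
      simp)
    rw [Submodule.mem_span_range_iff_exists_fun]
    refine ⟨b, ?_⟩
    ext1 j
    have := congrFun hb (Fin.castAdd n j)
    rw [Fin.append_left] at this
    rw [this]
    simp

end Kernel

/-- There is a function `Θ`, independent of `N` and `K`, such that: given an
`m × r` matrix `𝓠` over `R = K[x_1, …, x_N]` (`K` algebraically closed) with entries of degree
at most `d`, regarded as a map `R^r → R^m`, and a submodule `M ⊆ R^m` generated by at most `n`
elements of degree at most `d`, the kernel of the composite `R^r → R^m → R^m/M` is generated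
by at most `Θ m r n d` elements of degree at most `Θ m r n d`. -/
theorem statement11 :
    ∃ Θ : ℕ → ℕ → ℕ → ℕ → ℕ,
      ∀ (K : Type u) [Field K] [IsAlgClosed K] (N m r n d : ℕ)
        (𝓠 : Matrix (Fin m) (Fin r) (MvPolynomial (Fin N) K)),
        (∀ i j, (𝓠 i j).totalDegree ≤ d) →
        ∀ g : Fin n → (Fin m → MvPolynomial (Fin N) K),
          (∀ a l, (g a l).totalDegree ≤ d) →
          ∃ h : Fin (Θ m r n d) → (Fin r → MvPolynomial (Fin N) K),
            (∀ a l, (h a l).totalDegree ≤ Θ m r n d) ∧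
            Submodule.span (MvPolynomial (Fin N) K) (Set.range h) =
              LinearMap.ker
                ((Submodule.span (MvPolynomial (Fin N) K) (Set.range g)).mkQ ∘ₗ
                  𝓠.mulVecLin) := by
  choose β hβ using exists_kerBounded_row_of_isAlgClosed.{u}
  obtain ⟨β', hβ'⟩ := exists_kerBounded_matrix.{0, u} β
  refine ⟨fun m r n d => β' m (r + n) d, fun K _ _ N m r n d A hA g hg => ?_⟩
  refine exists_span_eq_ker_mkQ_comp A g (hβ' (Fin N) K (fun r D v => hβ r D K N v) _ _ _ _ ?_)
  exact fun i j => Fin.addCases (fun j => by simpa using hA i j) (fun j => by simpa using hg j i) j
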